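/- There exists a family (μ^ω)_{ω∈Ω} of finite Borel measures on J_∞, with ω ↦ μ^ω([i]) measurable for every i ∈ J and with ℙ-a.s. 0 < μ^ω(J_∞) < ∞, such that for every t with 0 < t < min{s, d} the expected t-energy of the pushforward π(·,ω)_*μ^ω is finite: ∫_Ω ∬_{J_∞×J_∞} |π(i,ω) − π(j,ω)|^{−t} dμ^ω(i) dμ^ω(j) dℙ(ω) < ∞. -/

import Mathlib

open MeasureTheory Filter Topology
open scoped ENNReal

noncomputable section

abbrev E (d : ℕ) : Type := EuclideanSpace ℝ (Fin d)

abbrev Od (d : ℕ) : Type := Matrix.orthogonalGroup (Fin d) ℝ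

instance (d : ℕ) : MeasurableSpace (Od d) := borel _
instance (d : ℕ) : BorelSpace (Od d) := ⟨rfl⟩

/-- The action of an orthogonal matrix on Euclidean space, as a linear map. -/
def act (d : ℕ) (Q : Od d) : E d →ₗ[ℝ] E d :=
  Matrix.toEuclideanLin (Q : Matrix (Fin d) (Fin d) ℝ)

/-- The set `J` of finite nonempty words: a word of length `k+1` is a function
`Fin (k+1) → Fin m`. -/
abbrev JW (m : ℕ) : Type := Σ k : ℕ, (Fin (k + 1) → Fin m)

noncomputable instance (m : ℕ) : DecidableEq (JW m) := fun _ _ => Classical.dec _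

/-- The label space `(σ₋,σ₊) × O(d)`. -/
abbrev Label (d : ℕ) (σm σp : ℝ) : Type := ↥(Set.Ioo σm σp) × Od d

/-- The space `Ω` of labelled trees. -/
abbrev Omega (d m : ℕ) (σm σp : ℝ) : Type := JW m → Label d σm σp

variable {d m : ℕ} {σm σp : ℝ}

/-- The similarity map `T_i^ω = r_i^ω • Q_i^ω` attached to the node `w`. -/
def Tnode (ω : Omega d m σm σp) (w : JW m) : E d →ₗ[ℝ] E d :=
  ((ω w).1 : ℝ) • act d (ω w).2

/-- The initial word `𝐢_{k+1}` (first `k+1` symbols) of an infinite word `i`. -/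
def pre (i : ℕ → Fin m) (k : ℕ) : JW m := ⟨k, fun j => i j.1⟩

/-- `cumT ω i n = T_{𝐢_1} ∘ ⋯ ∘ T_{𝐢_n}`. -/
def cumT (ω : Omega d m σm σp) (i : ℕ → Fin m) : ℕ → (E d →ₗ[ℝ] E d)
  | 0 => LinearMap.id
  | n + 1 => (cumT ω i n).comp (Tnode ω (pre i n))

/-- `cumR ω i n = 𝐫_{𝐢_n}^ω = r_{𝐢_1}^ω ⋯ r_{𝐢_n}^ω` (equal to 1 if `n = 0`). -/
def cumR (ω : Omega d m σm σp) (i : ℕ → Fin m) (n : ℕ) : ℝ :=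
  ∏ k ∈ Finset.range n, ((ω (pre i k)).1 : ℝ)

/-- `𝐫_w^ω` for a finite word `w`. -/
def wordR (ω : Omega d m σm σp) {k : ℕ} (w : Fin k → Fin m) : ℝ :=
  ∏ j : Fin k, ((ω ⟨j.1, fun t => w (Fin.castLE j.2 t)⟩).1 : ℝ)

/-- The `k`-th partial sum `a_{i_1} + T_{𝐢_1}(a_{i_2}) + ⋯ + T_{𝐢_1}∘⋯∘T_{𝐢_k}(a_{i_{k+1}})`. -/
def partialSum (a : Fin m → E d) (ω : Omega d m σm σp) (i : ℕ → Fin m) (k : ℕ) : E d :=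
  ∑ n ∈ Finset.range (k + 1), cumT ω i n (a (i n))

/-- The point `π(i, ω)`. -/
def piMap (a : Fin m → E d) (ω : Omega d m σm σp) (i : ℕ → Fin m) : E d :=
  ∑' n : ℕ, cumT ω i n (a (i n))

/-- `cumTFrom ω i p q = T_{𝐢_{p+2}} ∘ ⋯ ∘ T_{𝐢_{p+1+q}}`. -/
def cumTFrom (ω : Omega d m σm σp) (i : ℕ → Fin m) (p : ℕ) : ℕ → (E d →ₗ[ℝ] E d)
  | 0 => LinearMap.id
  | q + 1 => (cumTFrom ω i p q).comp (Tnode ω (pre i (p + 1 + q)))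

/-- The random vector `x(i, ω, p)`. -/
def xMap (a : Fin m → E d) (ω : Omega d m σm σp) (i : ℕ → Fin m) (p : ℕ) : E d :=
  ∑' q : ℕ, cumTFrom ω i p q (a (i (p + 1 + q)))

/-- The uniform probability measure on `(σ₋, σ₊)`, as a measure on `ℝ`. -/
def unif (σm σp : ℝ) : Measure ℝ :=
  (ENNReal.ofReal (σp - σm))⁻¹ • (volume.restrict (Set.Ioo σm σp))

/-- The uniform probability measure on `(σ₋, σ₊)`, as a measure on the subtype. -/
def unifSub (σm σp : ℝ) : Measure ↥(Set.Ioo σm σp) :=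
  (ENNReal.ofReal (σp - σm))⁻¹ • ((volume : Measure ℝ).comap Subtype.val)

/-- The measure `λ × θ` on the label space. -/
def labelM (σm σp : ℝ) {d : ℕ} (θ : Measure (Od d)) : Measure (Label d σm σp) :=
  (unifSub σm σp).prod θ

/-- The cylinder `[w]` of a finite word `w`. -/
def cyl {m k : ℕ} (w : Fin k → Fin m) : Set (ℕ → Fin m) := {j | ∀ t : Fin k, j t.1 = w t}

/-- The cylinder `[w]` of a node `w : JW m`. -/
def cylNode {m : ℕ} (w : JW m) : Set (ℕ → Fin m) := {j | ∀ t : Fin (w.1 + 1), j t.1 = w.2 t}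

/-- The σ-algebra `𝓕_k` generated by the labels at nodes of length at most `k`. -/
def Fk (d m : ℕ) (σm σp : ℝ) (k : ℕ) : MeasurableSpace (Omega d m σm σp) :=
  ⨆ w : {w : JW m // w.1 + 1 ≤ k}, MeasurableSpace.comap (fun ω => ω w.1) inferInstance

/-- `P` is the product measure `(λ×θ)^J`: coordinates are independent with law `λ×θ`. -/
def IsProductLaw (θ : Measure (Od d)) (P : Measure (Omega d m σm σp)) : Prop :=
  ∀ (S : Finset (JW m)) (A : JW m → Set (Label d σm σp)),
    (∀ w, MeasurableSet (A w)) →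
    P {ω | ∀ w ∈ S, ω w ∈ A w} = ∏ w ∈ S, labelM σm σp θ (A w)

/-- The uniformly random self-similar set `F(ω)`. -/
def Fset (a : Fin m → E d) (ω : Omega d m σm σp) : Set (E d) := Set.range (piMap a ω)

/-- `w` is an initial subword of `v`. -/
def isPrefix {m : ℕ} (w v : JW m) : Prop :=
  ∃ h : w.1 ≤ v.1, ∀ t : Fin (w.1 + 1), v.2 (Fin.castLE (Nat.succ_le_succ h) t) = w.2 t

end


instance secOd (d : ℕ) : SecondCountableTopology (Od d) := by
  have : SecondCountableTopology (Matrix (Fin d) (Fin d) ℝ) :=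
    inferInstanceAs (SecondCountableTopology (Fin d → Fin d → ℝ))
  exact TopologicalSpace.Subtype.secondCountableTopology _

lemma act_mul {d : ℕ} (Q R : Od d) (v : E d) : act d (Q * R) v = act d Q (act d R v) := by
  simp [act]

lemma act_one {d : ℕ} (v : E d) : act d 1 v = v := by
  simp [act]

lemma norm_act {d : ℕ} (Q : Od d) (v : E d) : ‖act d Q v‖ = ‖v‖ := by
  have h : ((Q : Matrix (Fin d) (Fin d) ℝ)).transpose * (Q : Matrix (Fin d) (Fin d) ℝ) = 1 := by
    have := (Matrix.mem_orthogonalGroup_iff' (Fin d) ℝ).1 Q.2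
    simpa [Matrix.star_eq_conjTranspose] using this
  have h2 : ‖act d Q v‖ ^ 2 = ‖v‖ ^ 2 := by
    rw [← real_inner_self_eq_norm_sq, ← real_inner_self_eq_norm_sq]
    simp only [act, Matrix.toLpLin_apply, EuclideanSpace.inner_eq_star_dotProduct]
    simp only [star_trivial]
    rw [Matrix.dotProduct_mulVec, Matrix.vecMul_mulVec, h]
    simp
  exact (sq_eq_sq₀ (norm_nonneg _) (norm_nonneg _)).1 h2

lemma continuous_act (d : ℕ) : Continuous fun p : Od d × E d => act d p.1 p.2 := by
  simp only [act, Matrix.toLpLin_apply]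
  refine (PiLp.continuous_toLp 2 _).comp ?_
  refine Continuous.matrix_mulVec (by fun_prop) ((PiLp.continuous_ofLp 2 _).comp continuous_snd)

lemma exists_act {d : ℕ} (u v : E d) (h : ‖u‖ = ‖v‖) : ∃ Q : Od d, act d Q u = v := by
  set f : E d ≃ₗᵢ[ℝ] E d := (ℝ ∙ (u - v))ᗮ.reflection with hf
  have hfu : f u = v := Submodule.reflection_sub h
  let b := EuclideanSpace.basisFun (Fin d) ℝ
  let M := LinearMap.toMatrixOrthonormal b f.toLinearEquiv.toLinearMap
  have hM : M ∈ Matrix.orthogonalGroup (Fin d) ℝ := by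
    rw [Matrix.mem_orthogonalGroup_iff']
    have : star M = LinearMap.toMatrixOrthonormal b (star (f.toLinearEquiv.toLinearMap)) :=
      (map_star (LinearMap.toMatrixOrthonormal b) _).symm
    rw [← map_one (LinearMap.toMatrixOrthonormal b)]
    have h3 : M.transpose = star M := by simp [Matrix.star_eq_conjTranspose]
    rw [h3, this, ← map_mul]
    congr 1
    ext1 x
    refine ext_inner_left ℝ fun y => ?_
    rw [Module.End.mul_apply, LinearMap.star_eq_adjoint, LinearMap.adjoint_inner_right]
    simp
  refine ⟨⟨M, hM⟩, ?_⟩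
  rw [← hfu]
  simp only [act]
  have : Matrix.toEuclideanLin M = f.toLinearEquiv.toLinearMap := by
    have := Matrix.toLin_toMatrix b.toBasis b.toBasis f.toLinearEquiv.toLinearMap
    rw [Matrix.toEuclideanLin_eq_toLin_orthonormal]
    exact this
  rw [this]; rfl

lemma continuous_inv_Od (d : ℕ) : Continuous fun p : Od d => p⁻¹ := continuous_inv

lemma continuous_act_inv_mul {d : ℕ} (w : E d) :
    Continuous fun p : Od d × Od d => act d (p.1⁻¹ * p.2) w := by
  have h1 : Continuous fun p : Od d × Od d => p.1⁻¹ := (continuous_inv_Od d).comp continuous_fst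
  have h2 : Continuous fun p : Od d × Od d => p.1⁻¹ * p.2 := h1.mul continuous_snd
  have h3 : Continuous fun p : Od d × Od d => (p.1⁻¹ * p.2, w) := h2.prodMk continuous_const
  have h5 := (continuous_act d).comp h3
  simp only [Function.comp_def] at h5
  exact h5

lemma sphere_avg {d : ℕ} (θ : Measure (Od d)) [IsProbabilityMeasure θ] [θ.IsMulLeftInvariant]
    (φ : E d → ℝ≥0∞) (hφ : Measurable φ) (u v : E d) (h : ‖u‖ = ‖v‖) :
    ∫⁻ Q, φ (act d Q u) ∂θ = ∫⁻ Q, φ (act d Q v) ∂θ := by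
  have key : ∀ w : E d, ∫⁻ Q, φ (act d Q w) ∂θ = ∫⁻ T, φ (act d T⁻¹ w) ∂θ := by
    intro w
    have h1 : ∀ T : Od d, ∫⁻ Q, φ (act d Q w) ∂θ = ∫⁻ Q, φ (act d (T⁻¹ * Q) w) ∂θ := fun T =>
      (lintegral_mul_left_eq_self (fun Q => φ (act d Q w)) T⁻¹).symm
    have hm : Measurable (Function.uncurry fun T Q : Od d => φ (act d (T⁻¹ * Q) w)) := by
      have h5 := hφ.comp (continuous_act_inv_mul w).measurable
      simpa only [Function.comp_def, Function.uncurry_def] using h5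
    calc ∫⁻ Q, φ (act d Q w) ∂θ = ∫⁻ T, ∫⁻ Q, φ (act d (T⁻¹ * Q) w) ∂θ ∂θ := by
          rw [← lintegral_congr h1]; simp
      _ = ∫⁻ Q, ∫⁻ T, φ (act d (T⁻¹ * Q) w) ∂θ ∂θ := lintegral_lintegral_swap hm.aemeasurable
      _ = ∫⁻ Q, ∫⁻ T, φ (act d T⁻¹ w) ∂θ ∂θ := by
          refine lintegral_congr fun Q => ?_
          rw [← lintegral_mul_left_eq_self (fun T => φ (act d (T⁻¹ * Q) w)) Q]
          simp
      _ = _ := by simp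
  obtain ⟨R, rfl⟩ := exists_act u v h
  rw [key, key, ← lintegral_mul_left_eq_self (fun T => φ (act d T⁻¹ (act d R u))) R]
  simp [← act_mul]

lemma riesz_bound {d : ℕ} (hd : 1 ≤ d) {t : ℝ} (ht : 0 < t) (htd : t < d) :
    ∃ C : ℝ≥0∞, C ≠ ⊤ ∧ ∀ z : E d,
      ∫⁻ y in Metric.ball (0 : E d) 1, ENNReal.ofReal ‖z + y‖ ^ (-t) ≤ C := by
  have : Nontrivial (E d) := by
    apply Module.nontrivial_of_finrank_pos (R := ℝ)
    simp; omega
  set B := Metric.ball (0 : E d) 1 with hB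
  have hmeas : Measurable fun y : E d => ENNReal.ofReal ‖y‖ ^ (-t) := by fun_prop
  have hfin : ∫⁻ y in B, ENNReal.ofReal ‖y‖ ^ (-t) ≠ ⊤ := by
    have hI : IntegrableOn (fun y : E d => ‖y‖ ^ (-t)) B := by
      refine integrableOn_ball_of_norm_le_rpow (C := 1) (α := t) (by simpa) (by simpa) ?_ ?_
      · refine .of_forall fun x => ?_
        rw [Real.norm_of_nonneg (by positivity)]; simp
      · exact (by fun_prop : Measurable fun y : E d => ‖y‖ ^ (-t)).aestronglyMeasurable
    have := hI.lintegral_lt_top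
    refine ne_of_lt (lt_of_eq_of_lt ?_ this)
    refine lintegral_congr_ae ?_
    have h0 : ∀ᵐ y : E d ∂(volume.restrict B), y ≠ 0 :=
      ae_restrict_of_ae (by simp [ae_iff])
    filter_upwards [h0] with y hy
    rw [ENNReal.ofReal_rpow_of_pos (norm_pos_iff.2 hy)]
  refine ⟨volume B + ∫⁻ y in B, ENNReal.ofReal ‖y‖ ^ (-t), ?_, fun z => ?_⟩
  · exact ENNReal.add_ne_top.2 ⟨measure_ball_lt_top.ne, hfin⟩
  calc ∫⁻ y in B, ENNReal.ofReal ‖z + y‖ ^ (-t)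
      = ∫⁻ y, B.indicator (fun y => ENNReal.ofReal ‖z + y‖ ^ (-t)) y := by
        rw [lintegral_indicator measurableSet_ball]
    _ ≤ ∫⁻ y, (B.indicator 1 y + (B.indicator (fun y => ENNReal.ofReal ‖y‖ ^ (-t))) (z + y)) := by
        refine lintegral_mono fun y => ?_
        by_cases hy : y ∈ B
        · by_cases hz : z + y ∈ B
          · simp [hy, hz]
          · simp only [Set.indicator_of_mem hy, Set.indicator_of_notMem hz]
            have : 1 ≤ ‖z + y‖ := by simpa [hB] using hz
            simp only [Pi.one_apply, add_zero]
            rw [ENNReal.rpow_neg]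
            refine ENNReal.inv_le_one.2 (ENNReal.one_le_rpow (by rw [← ENNReal.ofReal_one]; exact ENNReal.ofReal_le_ofReal this) ht)
        · simp [hy]
    _ = volume B + ∫⁻ y in B, ENNReal.ofReal ‖y‖ ^ (-t) := by
        rw [lintegral_add_left (measurable_one.indicator measurableSet_ball),
          lintegral_add_left_eq_self (fun y => B.indicator (fun y => ENNReal.ofReal ‖y‖ ^ (-t)) y) z,
          lintegral_indicator measurableSet_ball, lintegral_indicator measurableSet_ball]
        simp [hB]

lemma lintegral_labelM {d : ℕ} {σm σp : ℝ} (θ : Measure (Od d)) [IsProbabilityMeasure θ]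
    (g : Label d σm σp → ℝ≥0∞) (hg : Measurable g) (G : ℝ → ℝ≥0∞)
    (hG : ∀ r : Set.Ioo σm σp, ∫⁻ Q, g (r, Q) ∂θ = G r) :
    ∫⁻ l, g l ∂(labelM σm σp θ)
      = (ENNReal.ofReal (σp - σm))⁻¹ * ∫⁻ r in Set.Ioo σm σp, G r := by
  rw [labelM, lintegral_prod _ hg.aemeasurable, unifSub, lintegral_smul_measure, smul_eq_mul,
    ← lintegral_subtype_comap measurableSet_Ioo]
  congr 1
  exact lintegral_congr hG

lemma measurable_smul_act {d : ℕ} (e : E d) :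
    Measurable fun p : ℝ × Od d => p.1 • act d p.2 e := by
  have h3 : Continuous fun p : ℝ × Od d => (p.2, e) := by fun_prop
  have h5 := (continuous_act d).comp h3
  simp only [Function.comp_def] at h5
  have h6 := continuous_fst.smul h5
  exact h6.measurable

lemma polar_lower {d : ℕ} (hd : 1 ≤ d) {σm σp : ℝ} (hσ0 : 0 < σm) (hσ2 : σp < 1)
    (θ : Measure (Od d)) [IsProbabilityMeasure θ] [θ.IsMulLeftInvariant] :
    ∃ c : ℝ≥0∞, c ≠ 0 ∧ ∀ (φ : E d → ℝ≥0∞), Measurable φ → ∀ e : E d, ‖e‖ = 1 →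
      c * ∫⁻ r in Set.Ioo σm σp, ∫⁻ Q, φ (r • act d Q e) ∂θ ≤
        ∫⁻ y in Metric.ball (0 : E d) 1, φ y := by
  have : Nontrivial (E d) := by
    apply Module.nontrivial_of_finrank_pos (R := ℝ)
    simp; omega
  set μ : Measure (E d) := volume
  refine ⟨μ.toSphere Set.univ * ENNReal.ofReal (σm ^ (d - 1)), ?_, ?_⟩
  · refine mul_ne_zero ?_ ?_
    · rw [Measure.toSphere_apply_univ]
      simp only [finrank_euclideanSpace, Fintype.card_fin]
      refine mul_ne_zero (by simp; omega) (Metric.measure_ball_pos _ _ one_pos).ne'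
    · have : 0 < σm ^ (d - 1) := by positivity
      simpa using this
  intro φ hφ e he
  set ψ : E d → ℝ≥0∞ := (Metric.ball (0 : E d) 1).indicator φ with hψ
  have hψm : Measurable ψ := hφ.indicator measurableSet_ball
  set h : ℝ → ℝ≥0∞ := fun r => ∫⁻ Q, ψ (r • act d Q e) ∂θ with hh
  have hhm : Measurable h := by
    have h1 := hψm.comp (measurable_smul_act e)
    simp only [Function.comp_def] at h1
    exact h1.lintegral_prod_right'
  have hact : Measurable (Function.uncurry fun (y : E d) (Q : Od d) => ψ (act d Q y)) := by
    have h1 := hψm.comp ((continuous_act d).comp continuous_swap).measurable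
    simpa only [Function.comp_def, Function.uncurry_def, Prod.swap] using h1
  have hinv : ∀ Q : Od d, ∫⁻ y, ψ (act d Q y) ∂μ = ∫⁻ y, ψ y ∂μ := by
    intro Q
    let f : E d ≃ₗᵢ[ℝ] E d := LinearIsometryEquiv.mk
      (LinearEquiv.ofLinearMap (act d Q) (act d Q⁻¹)
        (by ext1 v; simp only [LinearMap.comp_apply, ← act_mul, mul_inv_cancel, act_one]; rfl)
        (by ext1 v; simp only [LinearMap.comp_apply, ← act_mul, inv_mul_cancel, act_one]; rfl))
      (fun v => norm_act Q v)
    have := (LinearIsometryEquiv.measurePreserving f).lintegral_comp hψm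
    exact this
  have h1 : ∫⁻ y, ψ y ∂μ = ∫⁻ y, h ‖y‖ ∂μ := by
    calc ∫⁻ y, ψ y ∂μ = ∫⁻ Q, ∫⁻ y, ψ (act d Q y) ∂μ ∂θ := by
          rw [lintegral_congr hinv]; simp
      _ = ∫⁻ y, ∫⁻ Q, ψ (act d Q y) ∂θ ∂μ := (lintegral_lintegral_swap hact.aemeasurable).symm
      _ = _ := by
          refine lintegral_congr fun y => ?_
          rw [sphere_avg θ ψ hψm y (‖y‖ • e) (by simp [norm_smul, he])]
          simp [hh]
  have h2 : ∫⁻ y, h ‖y‖ ∂μ = μ.toSphere Set.univ *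
      ∫⁻ x : Set.Ioi (0 : ℝ), h x ∂(Measure.volumeIoiPow (d - 1)) := by
    calc ∫⁻ y, h ‖y‖ ∂μ = ∫⁻ x : ({(0)}ᶜ : Set (E d)), h (‖x.1‖) ∂(μ.comap (↑)) := by
          rw [lintegral_subtype_comap (measurableSet_singleton _).compl fun x ↦ h (‖x‖),
            restrict_compl_singleton]
      _ = ∫⁻ x, h x.2 ∂μ.toSphere.prod (.volumeIoiPow (d - 1)) := by
          have hm' : Measurable fun x : Metric.sphere (0 : E d) 1 × Set.Ioi (0 : ℝ) => h x.2 := by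
            fun_prop
          have := μ.measurePreserving_homeomorphUnitSphereProd.lintegral_comp hm'
          simpa using this
      _ = _ := by
          rw [lintegral_prod _ (by fun_prop)]
          simp [mul_comm]
  have h3 : ∫⁻ x : Set.Ioi (0 : ℝ), h x ∂(Measure.volumeIoiPow (d - 1)) =
      ∫⁻ x in Set.Ioi (0 : ℝ), ENNReal.ofReal (x ^ (d - 1)) * h x := by
    rw [Measure.volumeIoiPow, lintegral_withDensity_eq_lintegral_mul _ (by fun_prop) (by fun_prop),
      ← lintegral_subtype_comap measurableSet_Ioi]
    rfl
  have h4 : ∫⁻ r in Set.Ioo σm σp, ∫⁻ Q, φ (r • act d Q e) ∂θ = ∫⁻ r in Set.Ioo σm σp, h r := by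
    refine setLIntegral_congr_fun measurableSet_Ioo fun r hr => ?_
    refine lintegral_congr fun Q => ?_
    rw [hψ, Set.indicator_of_mem]
    simp only [mem_ball_zero_iff, norm_smul, norm_act, he, mul_one, Real.norm_eq_abs]
    rw [abs_of_pos (hσ0.trans hr.1)]
    exact hr.2.trans hσ2
  rw [← lintegral_indicator measurableSet_ball, h1, h2, h3, h4, mul_assoc]
  gcongr
  rw [← lintegral_const_mul _ hhm]
  calc ∫⁻ r in Set.Ioo σm σp, ENNReal.ofReal (σm ^ (d - 1)) * h r
      ≤ ∫⁻ r in Set.Ioo σm σp, ENNReal.ofReal (r ^ (d - 1)) * h r := by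
        refine setLIntegral_mono' measurableSet_Ioo fun r hr => ?_
        gcongr
        exact hr.1.le
    _ ≤ _ := lintegral_mono_set fun r hr => hσ0.trans hr.1

lemma label_bound {d : ℕ} (hd : 1 ≤ d) {σm σp : ℝ} (hσ0 : 0 < σm) (hσ1 : σm < σp) (hσ2 : σp < 1)
    (θ : Measure (Od d)) [IsProbabilityMeasure θ] [θ.IsMulLeftInvariant]
    {t : ℝ} (ht : 0 < t) (htd : t < d) {c : ℝ} (hc : 0 < c) :
    ∃ C : ℝ≥0∞, C ≠ ⊤ ∧ ∀ x y : E d, c ≤ ‖x‖ →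
      ∫⁻ l, ENNReal.ofReal ‖y + (l.1 : ℝ) • act d l.2 x‖ ^ (-t) ∂(labelM σm σp θ) ≤ C := by
  obtain ⟨c₁, hc₁, H₁⟩ := polar_lower hd hσ0 hσ2 θ
  obtain ⟨C₂, hC₂, H₂⟩ := riesz_bound hd ht htd
  refine ⟨(ENNReal.ofReal (σp - σm))⁻¹ * (c₁⁻¹ * (ENNReal.ofReal c ^ (-t) * C₂)), ?_, ?_⟩
  · have : ENNReal.ofReal c ^ (-t) ≠ ⊤ := by
      rw [ENNReal.ofReal_rpow_of_pos hc]; exact ENNReal.ofReal_ne_top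
    finiteness
  intro x y hx
  have hx0 : 0 < ‖x‖ := hc.trans_le hx
  set e := ‖x‖⁻¹ • x with he
  have he1 : ‖e‖ = 1 := by simp [he, norm_smul, hx0.ne']
  have hxe : x = ‖x‖ • e := by simp [he, smul_smul, hx0.ne']
  set φ : E d → ℝ≥0∞ := fun u => ENNReal.ofReal ‖y + ‖x‖ • u‖ ^ (-t) with hφ
  have hφm : Measurable φ := by fun_prop
  rw [lintegral_labelM θ _ ?_ (fun r => ∫⁻ Q, φ (r • act d Q e) ∂θ) ?_]
  · gcongr
    have h1 := H₁ φ hφm e he1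
    have h2 : ∫⁻ u in Metric.ball (0 : E d) 1, φ u ≤ ENNReal.ofReal c ^ (-t) * C₂ := by
      calc ∫⁻ u in Metric.ball (0 : E d) 1, φ u
          ≤ ∫⁻ u in Metric.ball (0 : E d) 1, ENNReal.ofReal c ^ (-t) *
              ENNReal.ofReal ‖‖x‖⁻¹ • y + u‖ ^ (-t) := by
            refine lintegral_mono fun u => ?_
            have : y + ‖x‖ • u = ‖x‖ • (‖x‖⁻¹ • y + u) := by
              simp [smul_add, smul_smul, hx0.ne']
            simp only [hφ]
            rw [this, norm_smul, norm_norm, ENNReal.ofReal_mul hx0.le,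
              ENNReal.mul_rpow_of_ne_top (by simp) (by simp)]
            gcongr ?_ * _
            rw [ENNReal.rpow_neg, ENNReal.rpow_neg]
            gcongr
        _ ≤ _ := by
            rw [lintegral_const_mul _ (by fun_prop)]
            gcongr
            exact H₂ _
    have h3 := h1.trans h2
    by_cases hct : c₁ = ⊤
    · rw [hct] at h3
      have hfin : ENNReal.ofReal c ^ (-t) * C₂ ≠ ⊤ := by
        have : ENNReal.ofReal c ^ (-t) ≠ ⊤ := by
          rw [ENNReal.ofReal_rpow_of_pos hc]; exact ENNReal.ofReal_ne_top
        finiteness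
      by_cases hz : ∫⁻ r in Set.Ioo σm σp, ∫⁻ Q, φ (r • act d Q e) ∂θ = 0
      · rw [hz]; exact zero_le
      · rw [ENNReal.top_mul hz] at h3
        exact absurd (top_le_iff.1 h3) hfin
    · calc ∫⁻ r in Set.Ioo σm σp, ∫⁻ Q, φ (r • act d Q e) ∂θ
          = c₁⁻¹ * (c₁ * ∫⁻ r in Set.Ioo σm σp, ∫⁻ Q, φ (r • act d Q e) ∂θ) := by
            rw [← mul_assoc, ENNReal.inv_mul_cancel hc₁ hct, one_mul]
        _ ≤ _ := by gcongr
  · have h1 : Measurable fun p : ℝ × Od d => ENNReal.ofReal ‖y + p.1 • act d p.2 x‖ ^ (-t) := by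
      have := measurable_smul_act x
      fun_prop
    have h2 : Measurable fun l : Label d σm σp => ((l.1 : ℝ), l.2) := by fun_prop
    have h3 := h1.comp h2
    simpa only [Function.comp_def] using h3
  · intro r
    refine lintegral_congr fun Q => ?_
    simp only [hφ]
    congr 3
    conv_lhs => rw [hxe]
    rw [map_smul, smul_comm]


section cylmeasure
variable {m : ℕ}

abbrev Wd (m : ℕ) : Type := Σ k : ℕ, (Fin k → Fin m)

/-- prefix of length k -/
def pf (i : ℕ → Fin m) (k : ℕ) : Fin k → Fin m := fun j => i j

lemma mem_cyl_iff {k : ℕ} (w : Fin k → Fin m) (i : ℕ → Fin m) : i ∈ cyl w ↔ pf i k = w := by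
  simp [cyl, pf, funext_iff]

lemma pf_succ (i : ℕ → Fin m) (k : ℕ) :
    pf i (k + 1) = Fin.snoc (α := fun _ => Fin m) (pf i k) (i k) := by
  funext j
  refine Fin.lastCases ?_ (fun j => ?_) j <;> simp [pf]

lemma measurable_eval_countable {Ω ι β : Type*} [MeasurableSpace Ω] [MeasurableSpace β] [Countable ι]
    [MeasurableSpace ι] [MeasurableSingletonClass ι] (F : ι → Ω → β) (hF : ∀ i, Measurable (F i))
    (g : Ω → ι) (hg : Measurable g) : Measurable fun ω => F (g ω) ω := by
  have : Measurable fun p : ι × Ω => F p.1 p.2 := measurable_from_prod_countable_right hF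
  exact this.comp (hg.prodMk measurable_id)

def wdX (X : Wd m → Fin m) : (k : ℕ) → (Fin k → Fin m)
  | 0 => Fin.elim0
  | k + 1 => Fin.snoc (α := fun _ => Fin m) (wdX X k) (X ⟨k, wdX X k⟩)

def pathX (X : Wd m → Fin m) (k : ℕ) : Fin m := X ⟨k, wdX X k⟩

lemma pf_pathX (X : Wd m → Fin m) (k : ℕ) : pf (pathX X) k = wdX X k := by
  induction k with
  | zero => exact Subsingleton.elim _ _
  | succ k ih => rw [pf_succ, ih]; rfl

lemma pathX_eq (X : Wd m → Fin m) (k : ℕ) : pathX X k = X ⟨k, pf (pathX X) k⟩ := by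
  rw [pf_pathX]; rfl

lemma measurable_wdX (k : ℕ) : Measurable fun X : Wd m → Fin m => wdX X k := by
  induction k with
  | zero => exact measurable_const
  | succ k ih =>
    have h1 : Measurable fun X : Wd m → Fin m => X ⟨k, wdX X k⟩ :=
      measurable_eval_countable (fun (u : Fin k → Fin m) (X : Wd m → Fin m) => X ⟨k, u⟩)
        (fun u => measurable_pi_apply _) _ ih
    rw [measurable_pi_iff] at ih ⊢
    intro j
    refine Fin.lastCases ?_ (fun j => ?_) j
    · simpa [wdX] using h1
    · simpa [wdX] using ih j

lemma measurable_pathX : Measurable (pathX : (Wd m → Fin m) → (ℕ → Fin m)) := by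
  rw [measurable_pi_iff]
  intro k
  exact measurable_eval_countable (fun (u : Fin k → Fin m) (X : Wd m → Fin m) => X ⟨k, u⟩)
        (fun u => measurable_pi_apply _) _ (measurable_wdX k)

lemma pathX_mem_cyl {k : ℕ} (w : Fin k → Fin m) (X : Wd m → Fin m) :
    pathX X ∈ cyl w ↔ ∀ t : Fin k, X ⟨t, fun j => w (Fin.castLE t.2.le j)⟩ = w t := by
  constructor
  · intro h t
    rw [← h t, pathX_eq]
    congr 2
    funext j
    exact (h (Fin.castLE t.2.le j)).symm
  · intro h ⟨t, ht⟩
    induction t using Nat.strong_induction_on with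
    | _ t ih =>
      rw [← h ⟨t, ht⟩]
      simp only
      rw [pathX_eq]
      congr 2
      funext j
      exact ih j j.2 (j.2.trans ht)

lemma measurableSet_cyl {k : ℕ} (w : Fin k → Fin m) : MeasurableSet (cyl w) := by
  have : cyl w = ⋂ t : Fin k, (fun i : ℕ → Fin m => i t) ⁻¹' {w t} := by
    ext i; simp [cyl]
  rw [this]
  exact MeasurableSet.iInter fun t => measurable_pi_apply _ (measurableSet_singleton _)

lemma exists_cyl_measure (hm : 0 < m) (c : (k : ℕ) → (Fin k → Fin m) → ℝ≥0∞)
    (hfin : ∀ k w, c k w ≠ ⊤)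
    (hadd : ∀ k w, c k w = ∑ a, c (k + 1) (Fin.snoc (α := fun _ => Fin m) w a)) :
    ∃ μ : Measure (ℕ → Fin m), IsFiniteMeasure μ ∧ ∀ k w, μ (cyl w) = c k w := by
  classical
  let p : Wd m → Measure (Fin m) := fun x =>
    if c x.1 x.2 = 0 then Measure.dirac ⟨0, hm⟩ else
      ∑ a, (c (x.1 + 1) (Fin.snoc (α := fun _ => Fin m) x.2 a) / c x.1 x.2) • Measure.dirac a
  have hp : ∀ x, IsProbabilityMeasure (p x) := by
    intro x
    simp only [p]
    split_ifs with h
    · infer_instance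
    · constructor
      simp only [Measure.coe_finsetSum, Finset.sum_apply, Measure.smul_apply, measure_univ,
        smul_eq_mul, mul_one, div_eq_mul_inv]
      rw [← Finset.sum_mul, ← hadd]
      exact ENNReal.mul_inv_cancel h (hfin _ _)
  have hpc : ∀ k (w : Fin k → Fin m) b, c k w * p ⟨k, w⟩ {b} =
      c (k + 1) (Fin.snoc (α := fun _ => Fin m) w b) := by
    intro k w b
    simp only [p]
    split_ifs with h
    · rw [h, zero_mul]
      rw [hadd, Finset.sum_eq_zero_iff] at h
      exact (h b (Finset.mem_univ _)).symm
    · simp only [Measure.coe_finsetSum, Finset.sum_apply, Measure.smul_apply, smul_eq_mul]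
      rw [Finset.sum_eq_single b]
      · simp [ENNReal.mul_div_cancel h (hfin _ _)]
      · intro a _ hab
        simp [hab]
      · simp
  let ν := Measure.infinitePi p
  have hprod : ∀ k (w : Fin k → Fin m),
      c 0 Fin.elim0 * ∏ t : Fin k, p ⟨t, fun j => w (Fin.castLE t.2.le j)⟩ {w t} = c k w := by
    intro k
    induction k with
    | zero => intro w; simp [Subsingleton.elim w Fin.elim0]
    | succ k ih =>
      intro w
      rw [Fin.prod_univ_castSucc, ← mul_assoc]
      have h1 := ih (Fin.init w)
      have h2 : ∏ t : Fin k, p ⟨(t.castSucc : Fin (k + 1)), fun j => w (Fin.castLE t.castSucc.2.le j)⟩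
            {w t.castSucc}
          = ∏ t : Fin k, p ⟨t, fun j => Fin.init w (Fin.castLE t.2.le j)⟩ {Fin.init w t} := rfl
      rw [h2, h1]
      have h3 := hpc k (Fin.init w) (w (Fin.last k))
      rw [Fin.snoc_init_self] at h3
      exact h3
  have hνcyl : ∀ k (w : Fin k → Fin m), (ν.map pathX) (cyl w) =
      ∏ t : Fin k, p ⟨t, fun j => w (Fin.castLE t.2.le j)⟩ {w t} := by
    intro k w
    rw [Measure.map_apply measurable_pathX (measurableSet_cyl w)]
    let emb : Fin k → Wd m := fun t => ⟨t, fun j => w (Fin.castLE t.2.le j)⟩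
    have hemb : Function.Injective emb := by
      intro t t' h
      have := congrArg Sigma.fst h
      exact Fin.ext this
    let B : Wd m → Set (Fin m) := fun x => if h : x.1 < k then {w ⟨x.1, h⟩} else Set.univ
    have hset : pathX ⁻¹' cyl w = Set.pi (Finset.univ.image emb : Finset (Wd m)) B := by
      ext X
      rw [Set.mem_preimage, pathX_mem_cyl]
      simp [Set.mem_pi, emb, B]
    rw [hset, Measure.infinitePi_pi _ (fun i _ => MeasurableSet.of_discrete),
      Finset.prod_image hemb.injOn]
    refine Finset.prod_congr rfl fun t _ => ?_
    simp [emb, B]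
  refine ⟨c 0 Fin.elim0 • ν.map pathX, ?_, fun k w => ?_⟩
  · have : IsProbabilityMeasure (ν.map pathX) :=
      Measure.isProbabilityMeasure_map measurable_pathX.aemeasurable
    exact ⟨by simp [(hfin 0 Fin.elim0).lt_top]⟩
  · rw [Measure.smul_apply, hνcyl, smul_eq_mul, hprod]

/-- the pi-system of cylinders -/
def cylSys (m : ℕ) : Set (Set (ℕ → Fin m)) := {s | s = ∅ ∨ ∃ k, ∃ w : Fin k → Fin m, s = cyl w}

lemma cyl_inter {k l : ℕ} (hkl : k ≤ l) (w : Fin k → Fin m) (v : Fin l → Fin m) :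
    cyl w ∩ cyl v = if (fun j => v (Fin.castLE hkl j)) = w then cyl v else ∅ := by
  split_ifs with h
  · subst h
    refine Set.inter_eq_right.2 fun i hi j => ?_
    exact hi (Fin.castLE hkl j)
  · rw [Set.eq_empty_iff_forall_notMem]
    rintro i ⟨h1, h2⟩
    apply h
    funext j
    rw [← h1 j, ← h2 (Fin.castLE hkl j)]
    rfl

lemma isPiSystem_cylSys : IsPiSystem (cylSys m) := by
  rintro s (rfl | ⟨k, w, rfl⟩) u (rfl | ⟨l, v, rfl⟩) -
  · left; simp
  · left; simp
  · left; simp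
  · rcases le_total k l with h | h
    · rw [cyl_inter h]
      split_ifs
      · exact Or.inr ⟨_, _, rfl⟩
      · exact Or.inl rfl
    · rw [Set.inter_comm, cyl_inter h]
      split_ifs
      · exact Or.inr ⟨_, _, rfl⟩
      · exact Or.inl rfl

lemma generateFrom_cylSys :
    (inferInstance : MeasurableSpace (ℕ → Fin m)) = MeasurableSpace.generateFrom (cylSys m) := by
  apply le_antisymm
  · change MeasurableSpace.pi ≤ _
    refine iSup_le fun n => ?_
    rw [MeasurableSpace.comap_le_iff_le_map]
    intro s _
    change MeasurableSet[MeasurableSpace.generateFrom (cylSys m)] ((fun b : ℕ → Fin m => b n) ⁻¹' s)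
    have : (fun b : ℕ → Fin m => b n) ⁻¹' s =
        ⋃ w : {w : Fin (n + 1) → Fin m // w (Fin.last n) ∈ s}, cyl w.1 := by
      ext i
      simp only [Set.mem_preimage, Set.mem_iUnion]
      constructor
      · intro h
        exact ⟨⟨pf i (n + 1), h⟩, fun t => rfl⟩
      · rintro ⟨w, hw⟩
        have := hw (Fin.last n)
        simp only [Fin.val_last] at this
        rw [this]
        exact w.2
    rw [this]
    refine MeasurableSet.iUnion fun w => ?_
    exact MeasurableSpace.measurableSet_generateFrom (Or.inr ⟨_, _, rfl⟩)
  · refine MeasurableSpace.generateFrom_le ?_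
    rintro s (rfl | ⟨k, w, rfl⟩)
    · exact MeasurableSet.empty
    · exact measurableSet_cyl w

lemma cyl_zero (w : Fin 0 → Fin m) : cyl w = Set.univ := by
  ext i; simp [cyl]

/-- scaling on a cylinder -/
lemma restrict_cyl_eq (μ ν : Measure (ℕ → Fin m)) [IsFiniteMeasure μ] {κ : ℝ≥0∞}
    {k : ℕ} (w : Fin k → Fin m)
    (h : ∀ l (hl : k ≤ l) (v : Fin l → Fin m), (fun j => v (Fin.castLE hl j)) = w →
      μ (cyl v) = κ * ν (cyl v)) :
    μ.restrict (cyl w) = κ • ν.restrict (cyl w) := by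
  refine ext_of_generate_finite _ generateFrom_cylSys isPiSystem_cylSys ?_ ?_
  · rintro s (rfl | ⟨l, v, rfl⟩)
    · simp
    · rw [Measure.smul_apply, Measure.restrict_apply (measurableSet_cyl v),
        Measure.restrict_apply (measurableSet_cyl v), smul_eq_mul]
      rcases le_total k l with hkl | hkl
      · rw [Set.inter_comm, cyl_inter hkl]
        split_ifs with hh
        · exact h l hkl v hh
        · simp
      · rw [cyl_inter hkl]
        split_ifs with hh
        · exact h k le_rfl w rfl
        · simp
  · simp only [Measure.smul_apply, Measure.restrict_apply MeasurableSet.univ, Set.univ_inter,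
      smul_eq_mul]
    exact h k le_rfl w rfl

end cylmeasure


set_option linter.unusedSectionVars false

section indep
variable {ι L : Type*} [MeasurableSpace L]

open Classical in
/-- resampling the coordinates in `A` -/
noncomputable def resamp (A : Set ι) (p : (ι → L) × (ι → L)) : ι → L := A.piecewise p.2 p.1

lemma resamp_in {A : Set ι} (p : (ι → L) × (ι → L)) {i : ι} (hi : i ∈ A) :
    resamp A p i = p.2 i := by simp [resamp, hi]

lemma resamp_out {A : Set ι} (p : (ι → L) × (ι → L)) {i : ι} (hi : i ∉ A) :
    resamp A p i = p.1 i := by simp [resamp, hi]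

lemma measurable_resamp (A : Set ι) : Measurable (resamp A : (ι → L) × (ι → L) → (ι → L)) := by
  classical
  rw [measurable_pi_iff]
  intro i
  by_cases hi : i ∈ A
  · simp only [resamp_in _ hi]; fun_prop
  · simp only [resamp_out _ hi]; fun_prop

variable (ν : Measure L) [IsProbabilityMeasure ν]

lemma map_resamp (A : Set ι) :
    ((Measure.infinitePi (fun _ : ι => ν)).prod (Measure.infinitePi (fun _ : ι => ν))).map (resamp A)
      = Measure.infinitePi (fun _ : ι => ν) := by
  classical
  refine Measure.eq_infinitePi _ ?_
  intro S t ht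
  rw [Measure.map_apply (measurable_resamp A)
    (MeasurableSet.pi S.countable_toSet (fun i _ => ht i))]
  have : resamp A ⁻¹' (Set.pi S t) =
      (Set.pi (S.filter (· ∉ A) : Finset ι) t) ×ˢ (Set.pi (S.filter (· ∈ A) : Finset ι) t) := by
    ext p
    simp only [Set.mem_preimage, Set.mem_pi, Set.mem_prod, Finset.coe_filter, Set.mem_ofPred_eq,
      Finset.mem_coe]
    constructor
    · intro h
      refine ⟨fun i hi => ?_, fun i hi => ?_⟩
      · rw [← resamp_out p hi.2]; exact h i hi.1
      · rw [← resamp_in p hi.2]; exact h i hi.1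
    · rintro ⟨h1, h2⟩ i hi
      by_cases hA : i ∈ A
      · rw [resamp_in p hA]; exact h2 i ⟨hi, hA⟩
      · rw [resamp_out p hA]; exact h1 i ⟨hi, hA⟩
  rw [this, Measure.prod_prod, Measure.infinitePi_pi, Measure.infinitePi_pi, mul_comm,
    Finset.prod_filter_mul_prod_filter_not]
  · intro i _; exact ht i
  · intro i _; exact ht i

lemma dep_resamp_in {β : Type*} {f : (ι → L) → β} {A : Set ι} (hf : DependsOn f A)
    (p : (ι → L) × (ι → L)) : f (resamp A p) = f p.2 :=
  hf fun _ hi => resamp_in p hi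

lemma dep_resamp_out {β : Type*} {f : (ι → L) → β} {A B : Set ι} (hf : DependsOn f B)
    (h : Disjoint A B) (p : (ι → L) × (ι → L)) : f (resamp A p) = f p.1 :=
  hf fun _ hi => resamp_out p (h.notMem_of_mem_right hi)

lemma lintegral_indep {f g : (ι → L) → ℝ≥0∞} (hf : Measurable f) (hg : Measurable g)
    {A B : Set ι} (hfA : DependsOn f A) (hgB : DependsOn g B) (h : Disjoint A B) :
    ∫⁻ ω, f ω * g ω ∂(Measure.infinitePi (fun _ : ι => ν))
      = (∫⁻ ω, f ω ∂(Measure.infinitePi (fun _ : ι => ν))) *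
        ∫⁻ ω, g ω ∂(Measure.infinitePi (fun _ : ι => ν)) := by
  conv_lhs => rw [← map_resamp ν A]
  rw [lintegral_map (f := fun ω => f ω * g ω) (hf.mul hg) (measurable_resamp A)]
  simp only [dep_resamp_in hfA, dep_resamp_out hgB h]
  rw [mul_comm, ← lintegral_prod_mul hg.aemeasurable hf.aemeasurable]
  simp only [mul_comm]

lemma integral_indep {f g : (ι → L) → ℝ} (hf : Measurable f) (hg : Measurable g)
    {A B : Set ι} (hfA : DependsOn f A) (hgB : DependsOn g B) (h : Disjoint A B) :
    ∫ ω, f ω * g ω ∂(Measure.infinitePi (fun _ : ι => ν))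
      = (∫ ω, f ω ∂(Measure.infinitePi (fun _ : ι => ν))) *
        ∫ ω, g ω ∂(Measure.infinitePi (fun _ : ι => ν)) := by
  conv_lhs => rw [← map_resamp ν A]
  rw [integral_map (f := fun ω => f ω * g ω) (measurable_resamp A).aemeasurable (hf.mul hg).aestronglyMeasurable]
  simp only [dep_resamp_in hfA, dep_resamp_out hgB h]
  rw [mul_comm, ← integral_prod_mul]
  simp only [mul_comm]

lemma integral_eval {f : L → ℝ} (hf : Measurable f) (i : ι) :
    ∫ ω, f (ω i) ∂(Measure.infinitePi (fun _ : ι => ν)) = ∫ l, f l ∂ν := by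
  conv_rhs => rw [← (measurePreserving_eval_infinitePi (fun _ : ι => ν) i).map_eq]
  rw [integral_map (measurable_pi_apply _).aemeasurable hf.aestronglyMeasurable]

lemma lintegral_eval {f : L → ℝ≥0∞} (hf : Measurable f) (i : ι) :
    ∫⁻ ω, f (ω i) ∂(Measure.infinitePi (fun _ : ι => ν)) = ∫⁻ l, f l ∂ν := by
  conv_rhs => rw [← (measurePreserving_eval_infinitePi (fun _ : ι => ν) i).map_eq]
  rw [lintegral_map hf (measurable_pi_apply _)]

end indep

lemma DependsOn.mul' {ι L β : Type*} [Mul β] {f g : (ι → L) → β} {A B : Set ι}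
    (hf : DependsOn f A) (hg : DependsOn g B) : DependsOn (fun ω => f ω * g ω) (A ∪ B) := by
  intro x y h
  simp only
  rw [hf fun i hi => h i (Or.inl hi), hg fun i hi => h i (Or.inr hi)]

lemma DependsOn.comp' {ι L β γ : Type*} {f : (ι → L) → β} {A : Set ι}
    (hf : DependsOn f A) (g : β → γ) : DependsOn (fun ω => g (f ω)) A := by
  intro x y h
  simp only
  rw [hf h]

lemma dependsOn_eval {ι L : Type*} (i : ι) : DependsOn (fun ω : ι → L => ω i) {i} :=
  fun _ _ h => h i rfl

section tree
variable {m : ℕ}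

/-- append a letter -/
abbrev sn {k : ℕ} (w : Fin k → Fin m) (a : Fin m) : Fin (k + 1) → Fin m :=
  Fin.snoc (α := fun _ => Fin m) w a

/-- nodes strictly below `w` -/
def sub {k : ℕ} (w : Fin k → Fin m) : Set (JW m) :=
  {v | ∃ h : k ≤ v.1, (fun j : Fin k => v.2 (Fin.castLE (h.trans (Nat.le_succ _)) j)) = w}

/-- child node -/
def nd {k : ℕ} (w : Fin k → Fin m) (a : Fin m) : JW m := ⟨k, sn w a⟩

lemma nd_mem_sub {k : ℕ} (w : Fin k → Fin m) (a : Fin m) : nd w a ∈ sub w := by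
  refine ⟨le_rfl, ?_⟩
  funext j
  exact Fin.snoc_castSucc (α := fun _ => Fin m) _ _ j

lemma sub_sn_subset {k : ℕ} (w : Fin k → Fin m) (a : Fin m) : sub (sn w a) ⊆ sub w := by
  rintro v ⟨h, hv⟩
  refine ⟨by omega, ?_⟩
  funext j
  have := congrFun hv j.castSucc
  simp only [sn, Fin.snoc_castSucc] at this
  exact this

lemma nd_notMem_sub {k : ℕ} (w w' : Fin k → Fin m) (a b : Fin m) : nd w a ∉ sub (sn w' b) := by
  rintro ⟨h, -⟩
  simp [nd] at h

lemma disj_sub {k : ℕ} (w w' : Fin k → Fin m) (h : w ≠ w') : Disjoint (sub w) (sub w') := by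
  rw [Set.disjoint_left]
  rintro v ⟨h1, hv⟩ ⟨h2, hv'⟩
  exact h (hv.symm.trans hv')

lemma sn_inj {k : ℕ} {w w' : Fin k → Fin m} {a b : Fin m} (h : sn w a = sn w' b) :
    w = w' ∧ a = b := by
  have h1 := congrArg (Fin.init) h
  have h2 := congrFun h (Fin.last k)
  simp only [sn, Fin.init_snoc, Fin.snoc_last] at h1 h2
  exact ⟨h1, h2⟩

lemma disj_branch {k : ℕ} (w : Fin k → Fin m) {a b : Fin m} (h : a ≠ b) :
    Disjoint ({nd w a} ∪ sub (sn w a)) ({nd w b} ∪ sub (sn w b)) := by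
  rw [Set.disjoint_union_left, Set.disjoint_union_right, Set.disjoint_union_right]
  refine ⟨⟨?_, ?_⟩, ?_, ?_⟩
  · rw [Set.disjoint_singleton]
    intro hh
    have := eq_of_heq (Sigma.mk.inj hh).2
    exact h (sn_inj this).2
  · rw [Set.disjoint_singleton_left]; exact nd_notMem_sub _ _ _ _
  · rw [Set.disjoint_singleton_right]; exact nd_notMem_sub _ _ _ _
  · exact disj_sub _ _ fun hh => h (sn_inj hh).2

lemma branch_subset {k : ℕ} (w : Fin k → Fin m) (a : Fin m) :
    {nd w a} ∪ sub (sn w a) ⊆ sub w :=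
  Set.union_subset (Set.singleton_subset_iff.2 (nd_mem_sub w a)) (sub_sn_subset w a)

end tree

section casc
variable {m : ℕ} {L : Type*} (f : L → ℝ)

/-- cascade partial sums -/
noncomputable def Sc : ℕ → (k : ℕ) → (Fin k → Fin m) → (JW m → L) → ℝ
  | 0, _, _, _ => 1
  | n + 1, k, w, ω => ∑ a, f (ω (nd w a)) * Sc n (k + 1) (sn w a) ω

lemma Sc_succ (n k : ℕ) (w : Fin k → Fin m) (ω : JW m → L) :
    Sc f (n + 1) k w ω = ∑ a, f (ω (nd w a)) * Sc f n (k + 1) (sn w a) ω := rfl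

lemma Sc_nonneg (f0 : ∀ l, 0 < f l) (n k : ℕ) (w : Fin k → Fin m) (ω : JW m → L) :
    0 ≤ Sc f n k w ω := by
  induction n generalizing k with
  | zero => simp [Sc]
  | succ n ih => exact Finset.sum_nonneg fun a _ => mul_nonneg (f0 _).le (ih _ _)

lemma Sc_le (f0 : ∀ l, 0 < f l) (f1 : ∀ l, f l ≤ 1) (n k : ℕ) (w : Fin k → Fin m)
    (ω : JW m → L) : Sc f n k w ω ≤ (m : ℝ) ^ n := by
  induction n generalizing k with
  | zero => simp [Sc]
  | succ n ih =>
    rw [Sc_succ]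
    calc _ ≤ ∑ a : Fin m, 1 * (m : ℝ) ^ n := Finset.sum_le_sum fun a _ =>
            mul_le_mul (f1 _) (ih _ _) (Sc_nonneg f f0 _ _ _ _) zero_le_one
      _ = _ := by simp [pow_succ']

lemma Sc_dep (n k : ℕ) (w : Fin k → Fin m) : DependsOn (Sc f n k w) (sub w) := by
  induction n generalizing k with
  | zero => intro x y _; rfl
  | succ n ih =>
    intro x y h
    rw [Sc_succ, Sc_succ]
    refine Finset.sum_congr rfl fun a _ => ?_
    rw [h _ (nd_mem_sub w a), ih (k + 1) (sn w a) fun i hi => h i (sub_sn_subset w a hi)]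

lemma Sc_meas [MeasurableSpace L] (hf : Measurable f) (n k : ℕ) (w : Fin k → Fin m) :
    Measurable (Sc f n k w) := by
  induction n generalizing k with
  | zero => exact measurable_const
  | succ n ih =>
    have : Sc f (n + 1) k w = fun ω => ∑ a, f (ω (nd w a)) * Sc f n (k + 1) (sn w a) ω := rfl
    rw [this]
    refine Finset.measurable_sum _ fun a _ => ?_
    exact (hf.comp (measurable_pi_apply _)).mul (ih _ _)

variable [MeasurableSpace L] (ν : Measure L) [IsProbabilityMeasure ν]

/-- bounded measurable functions are integrable -/
lemma integrable_bdd {α : Type*} [MeasurableSpace α] {μ : Measure α} [IsFiniteMeasure μ]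
    {g : α → ℝ} (hg : Measurable g) {K : ℝ} (hK : ∀ x, |g x| ≤ K) : Integrable g μ :=
  Integrable.of_bound hg.aestronglyMeasurable K (Eventually.of_forall hK)

lemma step_moment (hf : Measurable f) (f0 : ∀ l, 0 < f l) (f1 : ∀ l, f l ≤ 1)
    (hmean : (m : ℝ) * ∫ l, f l ∂ν = 1) {q : ℝ} (hq : (m : ℝ) * ∫ l, f l ^ 2 ∂ν = q)
    {k : ℕ} (w : Fin k → Fin m) (Y : Fin m → (JW m → L) → ℝ) (hY : ∀ a, Measurable (Y a))
    (hYd : ∀ a, DependsOn (Y a) (sub (sn w a))) {K : ℝ} (hK : ∀ a ω, |Y a ω| ≤ K)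
    {e M : ℝ} (he : ∀ a, ∫ ω, Y a ω ∂(Measure.infinitePi (fun _ : JW m => ν)) = e)
    (hM : ∀ a, ∫ ω, Y a ω ^ 2 ∂(Measure.infinitePi (fun _ : JW m => ν)) ≤ M) :
    ∫ ω, ∑ a, f (ω (nd w a)) * Y a ω ∂(Measure.infinitePi (fun _ : JW m => ν)) = e ∧
    ∫ ω, (∑ a, f (ω (nd w a)) * Y a ω) ^ 2 ∂(Measure.infinitePi (fun _ : JW m => ν))
      ≤ q * M + e ^ 2 := by
  set P := Measure.infinitePi (fun _ : JW m => ν) with hP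
  have hfm : ∀ a, Measurable fun ω : JW m → L => f (ω (nd w a)) := fun a =>
    hf.comp (measurable_pi_apply _)
  have hfd : ∀ a, DependsOn (fun ω : JW m → L => f (ω (nd w a))) {nd w a} := fun a =>
    (dependsOn_eval (nd w a)).comp' f
  have hdis : ∀ a, Disjoint ({nd w a} : Set (JW m)) (sub (sn w a)) := fun a => by
    rw [Set.disjoint_singleton_left]; exact nd_notMem_sub _ _ _ _
  have hK0 : ∀ a : Fin m, ∀ ω : JW m → L, 0 ≤ K := fun a ω => (abs_nonneg _).trans (hK a ω)
  have hb : ∀ a ω, |f (ω (nd w a)) * Y a ω| ≤ K := by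
    intro a ω
    rw [abs_mul, abs_of_pos (f0 _)]
    calc _ ≤ 1 * K := mul_le_mul (f1 _) (hK a ω) (abs_nonneg _) zero_le_one
      _ = K := one_mul K
  have hm1 : ∀ a, Measurable fun ω => f (ω (nd w a)) * Y a ω := fun a => (hfm a).mul (hY a)
  have hi1 : ∀ a, Integrable (fun ω => f (ω (nd w a)) * Y a ω) P := fun a =>
    integrable_bdd (hm1 a) (hb a)
  have hE1 : ∀ a, ∫ ω, f (ω (nd w a)) * Y a ω ∂P = (∫ l, f l ∂ν) * e := by
    intro a
    rw [integral_indep ν (hfm a) (hY a) (hfd a) (hYd a) (hdis a), integral_eval ν hf, he]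
  have hE2 : ∀ a, ∫ ω, (f (ω (nd w a)) * Y a ω) ^ 2 ∂P ≤ (∫ l, f l ^ 2 ∂ν) * M := by
    intro a
    simp only [mul_pow]
    rw [integral_indep ν ((hfm a).pow_const 2) ((hY a).pow_const 2) ((hfd a).comp' (· ^ 2))
      ((hYd a).comp' (· ^ 2)) (hdis a), integral_eval ν (f := fun l => f l ^ 2) (hf.pow_const 2)]
    exact mul_le_mul_of_nonneg_left (hM a) (integral_nonneg fun l => sq_nonneg _)
  have hE3 : ∀ a b, a ≠ b → ∫ ω, (f (ω (nd w a)) * Y a ω) * (f (ω (nd w b)) * Y b ω) ∂P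
      = ((∫ l, f l ∂ν) * e) ^ 2 := by
    intro a b hab
    rw [integral_indep ν (hm1 a) (hm1 b) ((hfd a).mul' (hYd a)) ((hfd b).mul' (hYd b))
      (disj_branch w hab), hE1, hE1, sq]
  constructor
  · rw [integral_finsetSum _ fun a _ => hi1 a]
    simp only [hE1, Finset.sum_const, Finset.card_univ, Fintype.card_fin, nsmul_eq_mul]
    rw [← mul_assoc, hmean, one_mul]
  · simp only [sq (∑ a, _), Finset.sum_mul_sum]
    have hi2 : ∀ a b, Integrable (fun ω => (f (ω (nd w a)) * Y a ω) * (f (ω (nd w b)) * Y b ω)) P :=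
      fun a b => integrable_bdd (K := K * K) ((hm1 a).mul (hm1 b)) fun ω => by
        rw [abs_mul]
        exact mul_le_mul (hb a ω) (hb b ω) (abs_nonneg _) (hK0 a ω)
    rw [integral_finsetSum _ fun a _ => integrable_finsetSum _ fun b _ => hi2 a b]
    simp only [integral_finsetSum _ fun b _ => hi2 _ b]
    have hle : ∀ a b, ∫ ω, (f (ω (nd w a)) * Y a ω) * (f (ω (nd w b)) * Y b ω) ∂P
        ≤ (if a = b then (∫ l, f l ^ 2 ∂ν) * M else 0) + ((∫ l, f l ∂ν) * e) ^ 2 := by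
      intro a b
      split_ifs with h
      · subst h
        have := hE2 a
        simp only [sq (f _ * _)] at this
        nlinarith [sq_nonneg ((∫ l, f l ∂ν) * e)]
      · rw [hE3 a b h, zero_add]
    calc _ ≤ ∑ a : Fin m, ∑ b : Fin m,
          ((if a = b then (∫ l, f l ^ 2 ∂ν) * M else 0) + ((∫ l, f l ∂ν) * e) ^ 2) :=
          Finset.sum_le_sum fun a _ => Finset.sum_le_sum fun b _ => hle a b
      _ = (m * ∫ l, f l ^ 2 ∂ν) * M + ((m * ∫ l, f l ∂ν) * e) ^ 2 := by
        simp [Finset.sum_add_distrib]; ring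
      _ = _ := by rw [hq, hmean, one_mul]

lemma Sc_moment (hf : Measurable f) (f0 : ∀ l, 0 < f l) (f1 : ∀ l, f l ≤ 1)
    (hmean : (m : ℝ) * ∫ l, f l ∂ν = 1) {q : ℝ} (hq : (m : ℝ) * ∫ l, f l ^ 2 ∂ν = q) (hq0 : 0 ≤ q)
    (hq1 : q < 1)
    (n : ℕ) {k : ℕ} (w : Fin k → Fin m) :
    ∫ ω, Sc f n k w ω ∂(Measure.infinitePi (fun _ : JW m => ν)) = 1 ∧
    ∫ ω, Sc f n k w ω ^ 2 ∂(Measure.infinitePi (fun _ : JW m => ν)) ≤ 1 / (1 - q) := by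
  induction n generalizing k with
  | zero =>
    simp [Sc]
    exact (one_le_inv₀ (by linarith)).2 (by linarith)
  | succ n ih =>
    obtain ⟨h1, h2⟩ := step_moment f ν hf f0 f1 hmean hq w (fun a => Sc f n (k + 1) (sn w a))
      (fun a => Sc_meas f hf _ _ _) (fun a => Sc_dep f _ _ _) (K := (m : ℝ) ^ n)
      (fun a ω => by rw [abs_of_nonneg (Sc_nonneg f f0 _ _ _ _)]; exact Sc_le f f0 f1 _ _ _ _)
      (fun a => (ih (sn w a)).1) (fun a => (ih (sn w a)).2)
    refine ⟨h1, h2.trans (le_of_eq ?_)⟩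
    have : (1 - q) ≠ 0 := by linarith
    field_simp
    ring

lemma Sc_diff (hf : Measurable f) (f0 : ∀ l, 0 < f l) (f1 : ∀ l, f l ≤ 1)
    (hmean : (m : ℝ) * ∫ l, f l ∂ν = 1) {q : ℝ} (hq : (m : ℝ) * ∫ l, f l ^ 2 ∂ν = q) (hq0 : 0 ≤ q)
    (hq1 : q < 1)
    (n : ℕ) {k : ℕ} (w : Fin k → Fin m) :
    ∫ ω, (Sc f (n + 1) k w ω - Sc f n k w ω) ∂(Measure.infinitePi (fun _ : JW m => ν)) = 0 ∧
    ∫ ω, (Sc f (n + 1) k w ω - Sc f n k w ω) ^ 2 ∂(Measure.infinitePi (fun _ : JW m => ν))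
      ≤ q ^ n * (m + 1) ^ 2 := by
  induction n generalizing k with
  | zero =>
    have hi : ∀ n, Integrable (Sc f n k w) (Measure.infinitePi (fun _ : JW m => ν)) := fun n =>
      integrable_bdd (Sc_meas f hf _ _ _) (K := (m : ℝ) ^ n)
        fun ω => by rw [abs_of_nonneg (Sc_nonneg f f0 _ _ _ _)]; exact Sc_le f f0 f1 _ _ _ _
    constructor
    · rw [integral_sub (hi _) (hi _), (Sc_moment f ν hf f0 f1 hmean hq hq0 hq1 _ w).1,
        (Sc_moment f ν hf f0 f1 hmean hq hq0 hq1 _ w).1, sub_self]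
    · have hb : ∀ ω, (Sc f (0 + 1) k w ω - Sc f 0 k w ω) ^ 2 ≤ ((m : ℝ) + 1) ^ 2 := by
        intro ω
        have h1 := Sc_nonneg f f0 (0 + 1) k w ω
        have h2 := Sc_le f f0 f1 (0 + 1) k w ω
        rw [zero_add, pow_one] at h2
        have h3 : Sc f 0 k w ω = 1 := rfl
        rw [h3]
        simp only [zero_add] at *
        have hmn : (0 : ℝ) ≤ m := Nat.cast_nonneg m
        apply sq_le_sq'
        · linarith
        · linarith
      rw [pow_zero, one_mul]
      calc _ ≤ ∫ ω, ((m : ℝ) + 1) ^ 2 ∂(Measure.infinitePi (fun _ : JW m => ν)) := by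
            refine integral_mono_of_nonneg (Eventually.of_forall fun ω => sq_nonneg _)
              (integrable_const _) (Eventually.of_forall hb)
        _ = _ := by simp
  | succ n ih =>
    obtain ⟨h1, h2⟩ := step_moment f ν hf f0 f1 hmean hq w
      (fun a ω => Sc f (n + 1) (k + 1) (sn w a) ω - Sc f n (k + 1) (sn w a) ω)
      (fun a => (Sc_meas f hf _ _ _).sub (Sc_meas f hf _ _ _))
      (fun a x y h => by simp only; rw [Sc_dep f _ _ _ h, Sc_dep f _ _ _ h])
      (K := (m : ℝ) ^ (n + 1) + (m : ℝ) ^ n)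
      (fun a ω => by
        have h1 := Sc_nonneg f f0 (n + 1) (k + 1) (sn w a) ω
        have h2 := Sc_le f f0 f1 (n + 1) (k + 1) (sn w a) ω
        have h3 := Sc_nonneg f f0 n (k + 1) (sn w a) ω
        have h4 := Sc_le f f0 f1 n (k + 1) (sn w a) ω
        rw [abs_le]; constructor <;> linarith)
      (fun a => (ih (sn w a)).1) (fun a => (ih (sn w a)).2)
    have he : ∀ ω : JW m → L, ∑ a, f (ω (nd w a)) *
        (Sc f (n + 1) (k + 1) (sn w a) ω - Sc f n (k + 1) (sn w a) ω) =
        Sc f (n + 1 + 1) k w ω - Sc f (n + 1) k w ω := by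
      intro ω
      rw [Sc_succ f (n + 1), Sc_succ f n, ← Finset.sum_sub_distrib]
      simp only [mul_sub]
    simp only [he] at h1 h2
    refine ⟨h1, h2.trans (le_of_eq ?_)⟩
    ring

end casc


set_option linter.unusedSectionVars false

/-- hypotheses on the cascade weights -/
structure Casc (m : ℕ) {L : Type*} [MeasurableSpace L] (ν : Measure L) (f : L → ℝ) (q : ℝ) :
    Prop where
  hm : 2 ≤ m
  meas : Measurable f
  pos : ∀ l, 0 < f l
  le1 : ∀ l, f l ≤ 1
  mean : (m : ℝ) * ∫ l, f l ∂ν = 1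
  hq : (m : ℝ) * ∫ l, f l ^ 2 ∂ν = q
  q0 : 0 ≤ q
  q1 : q < 1

section rp
variable {m : ℕ} {L R : Type*} [CommMonoid R]

/-- product of `g` along the word -/
def Rp (g : L → R) {k : ℕ} (w : Fin k → Fin m) (ω : JW m → L) : R :=
  ∏ j : Fin k, g (ω ⟨j.1, fun t => w (Fin.castLE j.2 t)⟩)

lemma Rp_zero (g : L → R) (w : Fin 0 → Fin m) (ω : JW m → L) : Rp g w ω = 1 := by simp [Rp]

lemma Rp_sn (g : L → R) {k : ℕ} (w : Fin k → Fin m) (a : Fin m) (ω : JW m → L) :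
    Rp g (sn w a) ω = Rp g w ω * g (ω (nd w a)) := by
  rw [Rp, Fin.prod_univ_castSucc]
  congr 1
  refine Finset.prod_congr rfl fun j _ => ?_
  congr 2
  simp only [Fin.val_castSucc]
  congr 1
  funext t
  exact Fin.snoc_castSucc (α := fun _ => Fin m) _ _ (Fin.castLE j.2 t)

lemma Rp_dep (g : L → R) {k : ℕ} (w : Fin k → Fin m) :
    DependsOn (Rp g w) {v : JW m | v.1 < k} := by
  intro x y h
  refine Finset.prod_congr rfl fun j _ => ?_
  rw [h _ j.2]

lemma disj_Rp {k : ℕ} (w : Fin k → Fin m) : Disjoint {v : JW m | v.1 < k} (sub w) := by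
  rw [Set.disjoint_left]
  rintro v hv ⟨h, -⟩
  have : v.1 < k := hv
  omega

lemma lint_Rp [MeasurableSpace L] (ν : Measure L) [IsProbabilityMeasure ν] {g : L → ℝ≥0∞}
    (hg : Measurable g) {k : ℕ} (w : Fin k → Fin m) :
    Measurable (Rp g w) ∧ ∫⁻ ω, Rp g w ω ∂(Measure.infinitePi (fun _ : JW m => ν))
      = (∫⁻ l, g l ∂ν) ^ k := by
  have hmeas : ∀ k (w : Fin k → Fin m), Measurable (Rp g w) := fun k w =>
    Finset.measurable_prod _ fun j _ => hg.comp (measurable_pi_apply _)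
  refine ⟨hmeas _ _, ?_⟩
  induction k with
  | zero => simp [Rp_zero]
  | succ k ih =>
    rw [← Fin.snoc_init_self (α := fun _ => Fin m) w]
    have h := Rp_sn g (Fin.init (α := fun _ => Fin m) w) (w (Fin.last k))
    simp only [h]
    rw [lintegral_indep ν (hmeas _ _)
      (g := fun ω => g (ω (nd (Fin.init (α := fun _ => Fin m) w) (w (Fin.last k)))))
      (hg.comp (measurable_pi_apply _)) (Rp_dep g _)
      ((dependsOn_eval _).comp' g)
      (by rw [Set.disjoint_singleton_right]; exact fun h => lt_irrefl k h), ih,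
      lintegral_eval ν hg, pow_succ]

end rp

section conv
variable {m : ℕ} {L : Type*} [MeasurableSpace L] {ν : Measure L} [IsProbabilityMeasure ν]
  {f : L → ℝ} {q : ℝ}

local notation "PP" => Measure.infinitePi (fun _ : JW m => ν)

lemma Casc.ae_conv (H : Casc m ν f q) {k : ℕ} (w : Fin k → Fin m) :
    ∀ᵐ ω ∂PP, ∃ c, Tendsto (fun n => Sc f n k w ω) atTop (𝓝 c) := by
  set r := (1 + q) / 2 with hr
  have hr0 : 0 < r := by have := H.q0; rw [hr]; linarith
  have hr1 : r < 1 := by have := H.q1; rw [hr]; linarith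
  have hqr : q < r := by have := H.q1; rw [hr]; linarith
  set D : ℕ → (JW m → L) → ℝ := fun n ω => Sc f (n + 1) k w ω - Sc f n k w ω with hD
  have hDm : ∀ n, Measurable (D n) := fun n => (Sc_meas f H.meas _ _ _).sub (Sc_meas f H.meas _ _ _)
  have hDm' : ∀ n, Measurable fun ω => ENNReal.ofReal |D n ω| := fun n =>
    (hDm n).norm.ennreal_ofReal
  have hb : ∀ n, ∫⁻ ω, ENNReal.ofReal |D n ω| ∂PP ≤
      ENNReal.ofReal (r ^ n + (q / r) ^ n * (m + 1) ^ 2) := by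
    intro n
    have hrn : 0 < r ^ n := pow_pos hr0 n
    have h2 := (Sc_diff f ν H.meas H.pos H.le1 H.mean H.hq H.q0 H.q1 n w).2
    have hbd : ∀ ω, |D n ω| ≤ (m : ℝ) ^ (n + 1) + (m : ℝ) ^ n := by
      intro ω
      have h1 := Sc_nonneg f H.pos (n + 1) k w ω
      have h2 := Sc_le f H.pos H.le1 (n + 1) k w ω
      have h3 := Sc_nonneg f H.pos n k w ω
      have h4 := Sc_le f H.pos H.le1 n k w ω
      simp only [hD]
      rw [abs_le]; constructor <;> linarith
    have hi : Integrable (D n) PP := integrable_bdd (hDm n) hbd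
    have hi2 : Integrable (fun ω => D n ω ^ 2) PP :=
      integrable_bdd (K := ((m : ℝ) ^ (n + 1) + (m : ℝ) ^ n) ^ 2) ((hDm n).pow_const 2) fun ω => by
        rw [abs_pow]
        exact pow_le_pow_left₀ (abs_nonneg _) (hbd ω) 2
    rw [← ofReal_integral_eq_lintegral_ofReal hi.abs (Eventually.of_forall fun ω => abs_nonneg _)]
    apply ENNReal.ofReal_le_ofReal
    calc ∫ ω, |D n ω| ∂PP ≤ ∫ ω, (r ^ n + D n ω ^ 2 / r ^ n) ∂PP := by
          refine integral_mono hi.abs ((integrable_const _).add (hi2.div_const _)) fun ω => ?_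
          simp only
          rw [← sub_nonneg]
          have : r ^ n + D n ω ^ 2 / r ^ n - |D n ω| =
              ((r ^ n - |D n ω|) ^ 2 + r ^ n * |D n ω|) / r ^ n := by
            field_simp
            rw [← sq_abs (D n ω)]
            ring
          rw [this]
          positivity
      _ = r ^ n + (∫ ω, D n ω ^ 2 ∂PP) / r ^ n := by
          rw [integral_add (integrable_const _) (hi2.div_const _), integral_div]
          simp
      _ ≤ r ^ n + (q ^ n * (m + 1) ^ 2) / r ^ n := by gcongr
      _ = _ := by rw [div_pow q r, div_mul_eq_mul_div]
  have hsum : ∑' n, ENNReal.ofReal (r ^ n + (q / r) ^ n * (m + 1) ^ 2) ≠ ⊤ := by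
    have hs : Summable fun n => r ^ n + (q / r) ^ n * ((m : ℝ) + 1) ^ 2 :=
      (summable_geometric_of_lt_one hr0.le hr1).add
        ((summable_geometric_of_lt_one (div_nonneg H.q0 hr0.le) ((div_lt_one hr0).2 hqr)).mul_right _)
    exact hs.tsum_ofReal_ne_top
  have hfin : ∫⁻ ω, ∑' n, ENNReal.ofReal |D n ω| ∂PP ≠ ⊤ := by
    rw [lintegral_tsum fun n => (hDm' n).aemeasurable]
    exact ne_top_of_le_ne_top hsum (ENNReal.tsum_le_tsum hb)
  have hae := ae_lt_top (Measurable.tsum hDm') hfin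
  filter_upwards [hae] with ω hω
  apply cauchySeq_tendsto_of_complete
  refine cauchySeq_of_edist_le_of_tsum_ne_top (fun n => ENNReal.ofReal |D n ω|) (fun n => ?_) hω.ne
  rw [edist_comm, edist_dist, Real.dist_eq]

variable (f) in
/-- the good set -/
def Gd (m : ℕ) : Set (JW m → L) :=
  {ω | ∀ x : Wd m, ∃ c, Tendsto (fun n => Sc f n x.1 x.2 ω) atTop (𝓝 c)}

lemma Casc.measG (H : Casc m ν f q) : MeasurableSet (Gd f m) := by
  have : Gd f m = ⋂ x : Wd m, {ω | ∃ c, Tendsto (fun n => Sc f n x.1 x.2 ω) atTop (𝓝 c)} := by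
    ext ω; simp [Gd]
  rw [this]
  exact MeasurableSet.iInter fun x =>
    measurableSet_exists_tendsto fun n => Sc_meas f H.meas n x.1 x.2

lemma Casc.ae_G (H : Casc m ν f q) : ∀ᵐ ω ∂PP, ω ∈ Gd f m := by
  have : ∀ᵐ ω ∂PP, ∀ x : Wd m, ∃ c, Tendsto (fun n => Sc f n x.1 x.2 ω) atTop (𝓝 c) :=
    ae_all_iff.2 fun x => H.ae_conv x.2
  exact this

variable (f) in
/-- limit of the cascade -/
noncomputable def Wl {k : ℕ} (w : Fin k → Fin m) (ω : JW m → L) : ℝ≥0∞ :=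
  liminf (fun n => ENNReal.ofReal (Sc f n k w ω)) atTop

lemma Casc.measW (H : Casc m ν f q) {k : ℕ} (w : Fin k → Fin m) : Measurable (Wl f w) :=
  Measurable.liminf fun n => (Sc_meas f H.meas n k w).ennreal_ofReal

lemma Wl_dep {k : ℕ} (w : Fin k → Fin m) : DependsOn (Wl f w) (sub w) := by
  intro x y h
  simp only [Wl]
  congr 1
  funext n
  rw [Sc_dep f n k w h]

lemma Wl_tendsto {ω : JW m → L} (h : ω ∈ Gd f m) {k : ℕ} (w : Fin k → Fin m) :
    Tendsto (fun n => ENNReal.ofReal (Sc f n k w ω)) atTop (𝓝 (Wl f w ω)) ∧ Wl f w ω ≠ ⊤ := by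
  obtain ⟨c, hc⟩ := h ⟨k, w⟩
  have h1 : Tendsto (fun n => ENNReal.ofReal (Sc f n k w ω)) atTop (𝓝 (ENNReal.ofReal c)) :=
    ENNReal.tendsto_ofReal hc
  have h2 : Wl f w ω = ENNReal.ofReal c := h1.liminf_eq
  rw [h2]
  exact ⟨h1, ENNReal.ofReal_ne_top⟩

lemma Wl_add (f0 : ∀ l, 0 < f l) {ω : JW m → L} (h : ω ∈ Gd f m) {k : ℕ} (w : Fin k → Fin m) :
    Wl f w ω = ∑ a, ENNReal.ofReal (f (ω (nd w a))) * Wl f (sn w a) ω := by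
  have h1 := (Wl_tendsto h w).1.comp (tendsto_add_atTop_nat 1)
  have h2 : Tendsto (fun n => ∑ a, ENNReal.ofReal (f (ω (nd w a))) *
      ENNReal.ofReal (Sc f n (k + 1) (sn w a) ω)) atTop
      (𝓝 (∑ a, ENNReal.ofReal (f (ω (nd w a))) * Wl f (sn w a) ω)) := by
    refine tendsto_finsetSum _ fun a _ => ?_
    exact ENNReal.Tendsto.const_mul (Wl_tendsto h (sn w a)).1 (Or.inr ENNReal.ofReal_ne_top)
  refine tendsto_nhds_unique h1 (h2.congr fun n => ?_)
  simp only [Function.comp]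
  rw [Sc_succ, ENNReal.ofReal_sum_of_nonneg fun a _ =>
    mul_nonneg (f0 _).le (Sc_nonneg f f0 _ _ _ _)]
  refine Finset.sum_congr rfl fun a _ => ?_
  rw [ENNReal.ofReal_mul (f0 _).le]

lemma Casc.zero_le_q (H : Casc m ν f q) {k : ℕ} (w : Fin k → Fin m) :
    PP {ω | Wl f w ω = 0} ≤ ENNReal.ofReal q := by
  set B : ℝ := 1 / (1 - q) with hB
  have h1q : 0 < 1 - q := by have := H.q1; linarith
  have hB0 : 0 < B := by positivity
  have hmeas : MeasurableSet {ω : JW m → L | Wl f w ω = 0} :=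
    H.measW w (measurableSet_singleton 0)
  have hi : ∀ n, Integrable (Sc f n k w) PP := fun n =>
      integrable_bdd (Sc_meas f H.meas _ _ _) (K := (m : ℝ) ^ n)
        fun ω => by
          rw [abs_of_nonneg (Sc_nonneg f H.pos _ _ _ _)]; exact Sc_le f H.pos H.le1 _ _ _ _
  have hi2 : ∀ n, Integrable (fun ω => Sc f n k w ω ^ 2) PP := fun n =>
      integrable_bdd ((Sc_meas f H.meas _ _ _).pow_const 2) (K := ((m : ℝ) ^ n) ^ 2)
        fun ω => by
          rw [abs_pow, abs_of_nonneg (Sc_nonneg f H.pos _ _ _ _)]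
          exact pow_le_pow_left₀ (Sc_nonneg f H.pos _ _ _ _) (Sc_le f H.pos H.le1 _ _ _ _) 2
  have hle : ∀ n, ∫⁻ ω, ENNReal.ofReal ((Sc f n k w ω - B) ^ 2) ∂PP ≤ ENNReal.ofReal (B ^ 2 - B) := by
    intro n
    have he : (fun ω => (Sc f n k w ω - B) ^ 2) =
        fun ω => Sc f n k w ω ^ 2 - (2 * B) * Sc f n k w ω + B ^ 2 := by
      funext ω; ring
    have hint : Integrable (fun ω => (Sc f n k w ω - B) ^ 2) PP := by
      rw [he]
      exact ((hi2 n).sub ((hi n).const_mul _)).add (integrable_const _)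
    rw [← ofReal_integral_eq_lintegral_ofReal hint (Eventually.of_forall fun ω => sq_nonneg _)]
    apply ENNReal.ofReal_le_ofReal
    have hi3 : Integrable (fun ω => Sc f n k w ω ^ 2 - (2 * B) * Sc f n k w ω) PP :=
      (hi2 n).sub ((hi n).const_mul _)
    rw [he, integral_add hi3 (integrable_const _), integral_sub (hi2 n) ((hi n).const_mul _), integral_const_mul]
    have h := Sc_moment f ν H.meas H.pos H.le1 H.mean H.hq H.q0 H.q1 n w
    rw [h.1]
    have h2 := h.2
    simp
    linarith
  have hF : ∫⁻ ω, liminf (fun n => ENNReal.ofReal ((Sc f n k w ω - B) ^ 2)) atTop ∂PP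
      ≤ ENNReal.ofReal (B ^ 2 - B) := by
    refine (lintegral_liminf_le fun n =>
      (((Sc_meas f H.meas _ _ _).sub_const B).pow_const 2).ennreal_ofReal).trans ?_
    refine liminf_le_of_frequently_le' (Frequently.of_forall hle)
  have hlow : ENNReal.ofReal (B ^ 2) * PP {ω | Wl f w ω = 0} ≤ ENNReal.ofReal (B ^ 2 - B) := by
    refine le_trans ?_ hF
    rw [← lintegral_indicator_const hmeas]
    refine lintegral_mono_ae ?_
    filter_upwards [H.ae_G] with ω hω
    by_cases h0 : Wl f w ω = 0
    · rw [Set.indicator_of_mem (show ω ∈ {ω | Wl f w ω = 0} from h0)]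
      obtain ⟨c, hc⟩ := hω ⟨k, w⟩
      have h2 : Wl f w ω = ENNReal.ofReal c := (ENNReal.tendsto_ofReal hc).liminf_eq
      have hc0 : 0 ≤ c := ge_of_tendsto' hc fun n => Sc_nonneg f H.pos _ _ _ _
      have hc1 : c = 0 := by
        rw [h2, ENNReal.ofReal_eq_zero] at h0
        exact le_antisymm h0 hc0
      have h3 : Tendsto (fun n => ENNReal.ofReal ((Sc f n k w ω - B) ^ 2)) atTop
          (𝓝 (ENNReal.ofReal ((c - B) ^ 2))) :=
        ENNReal.tendsto_ofReal ((hc.sub_const B).pow 2)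
      rw [h3.liminf_eq, hc1]
      simp
    · rw [Set.indicator_of_notMem (show ω ∉ {ω | Wl f w ω = 0} from h0)]
      exact zero_le
  have hq' : ENNReal.ofReal (B ^ 2 - B) = ENNReal.ofReal (B ^ 2) * ENNReal.ofReal q := by
    rw [← ENNReal.ofReal_mul (by positivity)]
    congr 1
    rw [hB]
    field_simp
    ring
  rw [hq'] at hlow
  rwa [ENNReal.mul_le_mul_iff_right (by simp; positivity) ENNReal.ofReal_ne_top] at hlow

lemma Casc.pos_ae (H : Casc m ν f q) {k : ℕ} (w : Fin k → Fin m) :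
    ∀ᵐ ω ∂PP, Wl f w ω ≠ 0 := by
  have key : ∀ n : ℕ, ∀ (k : ℕ) (w : Fin k → Fin m), PP {ω | Wl f w ω = 0} ≤ ENNReal.ofReal q ^ (n + 1) := by
    intro n
    induction n with
    | zero => intro k w; simpa using H.zero_le_q w
    | succ n ih =>
      intro k w
      let a0 : Fin m := ⟨0, by have := H.hm; omega⟩
      let a1 : Fin m := ⟨1, by have := H.hm; omega⟩
      have hne : a0 ≠ a1 := by simp [a0, a1]
      have hms : ∀ b, MeasurableSet {ω : JW m → L | Wl f (sn w b) ω = 0} := fun b =>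
        H.measW _ (measurableSet_singleton 0)
      let φ : Fin m → (JW m → L) → ℝ≥0∞ := fun b =>
        ({0} : Set ℝ≥0∞).indicator (fun _ => 1) ∘ (Wl f (sn w b))
      have hφm : ∀ b, Measurable (φ b) := fun b =>
        (measurable_const.indicator (measurableSet_singleton 0)).comp (H.measW _)
      have hφi : ∀ b, ∫⁻ ω, φ b ω ∂PP = PP {ω | Wl f (sn w b) ω = 0} := by
        intro b
        rw [← lintegral_indicator_one (hms b)]
        rfl
      calc PP {ω | Wl f w ω = 0} ≤ ∫⁻ ω, φ a0 ω * φ a1 ω ∂PP := by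
            have hmw : MeasurableSet {ω : JW m → L | Wl f w ω = 0} :=
              H.measW w (measurableSet_singleton 0)
            rw [← lintegral_indicator_one hmw]
            refine lintegral_mono_ae ?_
            filter_upwards [H.ae_G] with ω hω
            by_cases h0 : Wl f w ω = 0
            · have h1 := h0
              rw [Wl_add H.pos hω, Finset.sum_eq_zero_iff] at h1
              have h2 : ∀ b, Wl f (sn w b) ω = 0 := by
                intro b
                have := h1 b (Finset.mem_univ _)
                rcases mul_eq_zero.1 this with h | h
                · rw [ENNReal.ofReal_eq_zero] at h
                  exact absurd (H.pos _) (not_lt.2 h)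
                · exact h
              simp [φ, h2, h0]
            · rw [Set.indicator_of_notMem (show ω ∉ {ω | Wl f w ω = 0} from h0)]
              exact zero_le
        _ = (∫⁻ ω, φ a0 ω ∂PP) * ∫⁻ ω, φ a1 ω ∂PP :=
            lintegral_indep ν (hφm a0) (hφm a1) ((Wl_dep _).comp' _) ((Wl_dep _).comp' _)
              (disj_sub _ _ fun hh => hne (sn_inj hh).2)
        _ ≤ ENNReal.ofReal q ^ (n + 1) * ENNReal.ofReal q := by
            rw [hφi, hφi]
            exact mul_le_mul' (ih _ _) (H.zero_le_q _)
        _ = _ := (pow_succ _ _).symm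
  have h0 : PP {ω | Wl f w ω = 0} ≤ 0 := by
    have ht : Tendsto (fun n : ℕ => ENNReal.ofReal q ^ (n + 1)) atTop (𝓝 0) :=
      (ENNReal.tendsto_pow_atTop_nhds_zero_of_lt_one
        (by rw [← ENNReal.ofReal_one]; exact (ENNReal.ofReal_lt_ofReal_iff one_pos).2 H.q1)).comp
        (tendsto_add_atTop_nat 1)
    exact ge_of_tendsto' ht fun n => key n k w
  rw [ae_iff]
  simpa using h0

lemma Casc.W_mean (H : Casc m ν f q) {k : ℕ} (w : Fin k → Fin m) : ∫⁻ ω, Wl f w ω ∂PP ≤ 1 := by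
  refine (lintegral_liminf_le fun n => (Sc_meas f H.meas _ _ _).ennreal_ofReal).trans ?_
  refine liminf_le_of_frequently_le' (Frequently.of_forall fun n => ?_)
  rw [← ofReal_integral_eq_lintegral_ofReal
    (integrable_bdd (Sc_meas f H.meas _ _ _) (K := (m : ℝ) ^ n)
        fun ω => by
          rw [abs_of_nonneg (Sc_nonneg f H.pos _ _ _ _)]; exact Sc_le f H.pos H.le1 _ _ _ _)
    (Eventually.of_forall fun ω => Sc_nonneg f H.pos _ _ _ _),
    (Sc_moment f ν H.meas H.pos H.le1 H.mean H.hq H.q0 H.q1 n w).1]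
  simp

lemma Casc.W_sq (H : Casc m ν f q) {k : ℕ} (w : Fin k → Fin m) :
    ∫⁻ ω, Wl f w ω ^ 2 ∂PP ≤ ENNReal.ofReal (1 / (1 - q)) := by
  have h1 : ∫⁻ ω, Wl f w ω ^ 2 ∂PP =
      ∫⁻ ω, liminf (fun n => ENNReal.ofReal (Sc f n k w ω ^ 2)) atTop ∂PP := by
    refine lintegral_congr_ae ?_
    filter_upwards [H.ae_G] with ω hω
    have h := (Wl_tendsto hω w)
    have h2 := ENNReal.Tendsto.pow (n := 2) h.1
    rw [← h2.liminf_eq]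
    congr 1
    funext n
    rw [ENNReal.ofReal_pow (Sc_nonneg f H.pos _ _ _ _)]
  rw [h1]
  refine (lintegral_liminf_le fun n => ((Sc_meas f H.meas _ _ _).pow_const 2).ennreal_ofReal).trans ?_
  refine liminf_le_of_frequently_le' (Frequently.of_forall fun n => ?_)
  rw [← ofReal_integral_eq_lintegral_ofReal
    (integrable_bdd ((Sc_meas f H.meas _ _ _).pow_const 2) (K := ((m : ℝ) ^ n) ^ 2)
        fun ω => by
          rw [abs_pow, abs_of_nonneg (Sc_nonneg f H.pos _ _ _ _)]
          exact pow_le_pow_left₀ (Sc_nonneg f H.pos _ _ _ _) (Sc_le f H.pos H.le1 _ _ _ _) 2)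
    (Eventually.of_forall fun ω => sq_nonneg _)]
  exact ENNReal.ofReal_le_ofReal (Sc_moment f ν H.meas H.pos H.le1 H.mean H.hq H.q0 H.q1 n w).2

open Classical in
variable (f) in
/-- cylinder masses -/
noncomputable def cm {k : ℕ} (w : Fin k → Fin m) (ω : JW m → L) : ℝ≥0∞ :=
  if ω ∈ Gd f m then Rp (fun l => ENNReal.ofReal (f l)) w ω * Wl f w ω else 0

lemma Casc.meas_cm (H : Casc m ν f q) {k : ℕ} (w : Fin k → Fin m) : Measurable (cm f w) := by
  classical
  have h : Measurable (Rp (fun l => ENNReal.ofReal (f l)) w) := (lint_Rp ν H.meas.ennreal_ofReal w).1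
  exact Measurable.ite H.measG (h.mul (H.measW w)) measurable_const

lemma Rp_ne_top {g : L → ℝ≥0∞} (hg : ∀ l, g l ≠ ⊤) {k : ℕ} (w : Fin k → Fin m) (ω : JW m → L) :
    Rp g w ω ≠ ⊤ := ENNReal.prod_ne_top fun _ _ => hg _

lemma Casc.exists_mu (H : Casc m ν f q) : ∃ μ : (JW m → L) → Measure (ℕ → Fin m),
    (∀ ω, IsFiniteMeasure (μ ω)) ∧ ∀ ω k (w : Fin k → Fin m), μ ω (cyl w) = cm f w ω := by
  have : ∀ ω : JW m → L, ∃ μ : Measure (ℕ → Fin m), IsFiniteMeasure μ ∧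
      ∀ k (w : Fin k → Fin m), μ (cyl w) = cm f w ω := by
    intro ω
    refine exists_cyl_measure (by have := H.hm; omega) (fun k w => cm f w ω) ?_ ?_
    · intro k w
      simp only [cm]
      split_ifs with h
      · exact ENNReal.mul_ne_top (Rp_ne_top (fun _ => ENNReal.ofReal_ne_top) _ _) (Wl_tendsto h w).2
      · simp
    · intro k w
      simp only [cm]
      split_ifs with h
      · rw [Wl_add H.pos h, Finset.mul_sum]
        refine Finset.sum_congr rfl fun a _ => ?_
        have := Rp_sn (fun l => ENNReal.ofReal (f l)) w a ω
        rw [sn] at this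
        rw [this, mul_assoc]
      · simp
  choose μ h1 h2 using this
  exact ⟨μ, h1, h2⟩

end conv


set_option linter.unusedSectionVars false

section geom
variable {d m : ℕ} {σm σp : ℝ}

/-- ratio of a label -/
def rad (l : Label d σm σp) : ℝ := (l.1 : ℝ)

lemma measurable_rad : Measurable (rad : Label d σm σp → ℝ) :=
  measurable_subtype_coe.comp measurable_fst

lemma rad_pos (hσ0 : 0 < σm) (l : Label d σm σp) : 0 < rad l := hσ0.trans l.1.2.1

lemma rad_le (l : Label d σm σp) : rad l ≤ σp := l.1.2.2.le

lemma pre_eq (i : ℕ → Fin m) (n : ℕ) : pre i n = nd (pf i n) (i n) := by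
  rw [nd, sn, ← pf_succ]; rfl

lemma norm_Tnode (hσ0 : 0 < σm) (ω : Omega d m σm σp) (u : JW m) (v : E d) :
    ‖Tnode ω u v‖ = rad (ω u) * ‖v‖ := by
  rw [Tnode, LinearMap.smul_apply, norm_smul, norm_act, Real.norm_eq_abs]
  exact congrArg (· * ‖v‖) (abs_of_pos (rad_pos hσ0 (ω u)))

lemma norm_cumT (hσ0 : 0 < σm) (ω : Omega d m σm σp) (i : ℕ → Fin m) (n : ℕ) (v : E d) :
    ‖cumT ω i n v‖ = Rp rad (pf i n) ω * ‖v‖ := by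
  induction n generalizing v with
  | zero => simp [cumT, Rp_zero]
  | succ n ih =>
    rw [cumT, LinearMap.comp_apply, ih, norm_Tnode hσ0, pf_succ]
    have := Rp_sn rad (pf i n) (i n) ω
    rw [sn] at this
    rw [this, pre_eq, mul_assoc]

lemma Rp_rad_nonneg (hσ0 : 0 < σm) {k : ℕ} (w : Fin k → Fin m) (ω : Omega d m σm σp) :
    0 < Rp rad w ω := Finset.prod_pos fun _ _ => rad_pos hσ0 _

lemma Rp_rad_le (hσ0 : 0 < σm) {k : ℕ} (w : Fin k → Fin m) (ω : Omega d m σm σp) :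
    Rp rad w ω ≤ σp ^ k := by
  calc Rp rad w ω ≤ ∏ j : Fin k, σp :=
        Finset.prod_le_prod (fun _ _ => (rad_pos hσ0 _).le) fun _ _ => rad_le _
    _ = _ := by simp

lemma norm_cumTFrom_le (hσ0 : 0 < σm) (hσp : 0 ≤ σp) (ω : Omega d m σm σp) (i : ℕ → Fin m) (p q : ℕ)
    (v : E d) : ‖cumTFrom ω i p q v‖ ≤ σp ^ q * ‖v‖ := by
  induction q generalizing v with
  | zero => simp [cumTFrom]
  | succ q ih =>
    rw [cumTFrom, LinearMap.comp_apply]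
    refine (ih _).trans ?_
    rw [norm_Tnode hσ0, pow_succ, mul_assoc]
    gcongr
    exact rad_le _

lemma exists_bound (a : Fin m → E d) : ∃ A : ℝ, 0 ≤ A ∧ ∀ k, ‖a k‖ ≤ A :=
  ⟨∑ k, ‖a k‖, Finset.sum_nonneg fun _ _ => norm_nonneg _, fun k =>
    Finset.single_le_sum (f := fun k => ‖a k‖) (fun _ _ => norm_nonneg _) (Finset.mem_univ k)⟩

lemma summable_cumT (hσ0 : 0 < σm) (hσp : 0 ≤ σp) (hσ2 : σp < 1) (a : Fin m → E d)
    (ω : Omega d m σm σp) (i : ℕ → Fin m) : Summable fun n => cumT ω i n (a (i n)) := by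
  obtain ⟨A, hA0, hA⟩ := exists_bound a
  refine Summable.of_norm_bounded
    ((summable_geometric_of_lt_one hσp hσ2).mul_right A) fun n => ?_
  rw [norm_cumT hσ0]
  exact mul_le_mul (Rp_rad_le hσ0 _ _) (hA _) (norm_nonneg _) (pow_nonneg hσp _)

lemma summable_cumTFrom (hσ0 : 0 < σm) (hσp : 0 ≤ σp) (hσ2 : σp < 1) (a : Fin m → E d)
    (ω : Omega d m σm σp) (i : ℕ → Fin m) (p : ℕ) :
    Summable fun q => cumTFrom ω i p q (a (i (p + 1 + q))) := by
  obtain ⟨A, hA0, hA⟩ := exists_bound a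
  refine Summable.of_norm_bounded
    ((summable_geometric_of_lt_one hσp hσ2).mul_right A) fun n => ?_
  refine (norm_cumTFrom_le hσ0 hσp _ _ _ _ _).trans ?_
  exact mul_le_mul le_rfl (hA _) (norm_nonneg _) (pow_nonneg hσp _)

lemma cumT_add (ω : Omega d m σm σp) (i : ℕ → Fin m) (p q : ℕ) (v : E d) :
    cumT ω i (p + 1 + q) v = cumT ω i (p + 1) (cumTFrom ω i p q v) := by
  induction q generalizing v with
  | zero => rfl
  | succ q ih =>
    rw [cumTFrom, LinearMap.comp_apply, ← ih, ← add_assoc, cumT, LinearMap.comp_apply]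

lemma piMap_decomp (hσ0 : 0 < σm) (hσp : 0 ≤ σp) (hσ2 : σp < 1) (a : Fin m → E d)
    (ω : Omega d m σm σp) (i : ℕ → Fin m) (p : ℕ) :
    piMap a ω i = ∑ n ∈ Finset.range p, cumT ω i n (a (i n)) +
      cumT ω i p (a (i p) + Tnode ω (pre i p) (xMap a ω i p)) := by
  rw [piMap, ← (summable_cumT hσ0 hσp hσ2 a ω i).sum_add_tsum_nat_add (p + 1),
    Finset.sum_range_succ, add_assoc, map_add]
  congr 2
  have h1 : ∀ q, cumT ω i (q + (p + 1)) (a (i (q + (p + 1)))) =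
      (cumT ω i (p + 1)).toContinuousLinearMap (cumTFrom ω i p q (a (i (p + 1 + q)))) := by
    intro q
    rw [add_comm q, cumT_add]
    rfl
  simp only [h1]
  rw [← ContinuousLinearMap.map_tsum _ (summable_cumTFrom hσ0 hσp hσ2 a ω i p)]
  rfl

lemma cumT_congr (ω : Omega d m σm σp) {i j : ℕ → Fin m} {p : ℕ} (h : ∀ n < p, i n = j n) :
    cumT ω i p = cumT ω j p := by
  induction p with
  | zero => rfl
  | succ p ih =>
    rw [cumT, cumT, ih fun n hn => h n (by omega)]
    have : pre i p = pre j p := by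
      simp only [pre]
      congr 1
      funext t
      exact h t (by omega)
    rw [this]

lemma piMap_sub (hσ0 : 0 < σm) (hσp : 0 ≤ σp) (hσ2 : σp < 1) (a : Fin m → E d)
    (ω : Omega d m σm σp) {i j : ℕ → Fin m} {p : ℕ} (w : Fin p → Fin m) {b c : Fin m}
    (hi : i ∈ cyl (sn w b)) (hj : j ∈ cyl (sn w c)) :
    ‖piMap a ω i - piMap a ω j‖ = Rp rad w ω *
      ‖(a b - a c) + Tnode ω (nd w b) (xMap a ω i p) - Tnode ω (nd w c) (xMap a ω j p)‖ := by
  rw [mem_cyl_iff, pf_succ] at hi hj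
  obtain ⟨hi1, hi2⟩ := sn_inj hi
  obtain ⟨hj1, hj2⟩ := sn_inj hj
  have hij : ∀ n < p, i n = j n := by
    intro n hn
    have := congrFun (hi1.trans hj1.symm) ⟨n, hn⟩
    exact this
  rw [piMap_decomp hσ0 hσp hσ2 a ω i p, piMap_decomp hσ0 hσp hσ2 a ω j p, pre_eq, pre_eq,
    hi1, hj1, hi2, hj2, ← cumT_congr ω hij]
  have hs : ∑ n ∈ Finset.range p, cumT ω i n (a (i n)) =
      ∑ n ∈ Finset.range p, cumT ω j n (a (j n)) := by
    refine Finset.sum_congr rfl fun n hn => ?_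
    rw [Finset.mem_range] at hn
    rw [hij n hn, cumT_congr ω fun n' hn' => hij n' (hn'.trans hn)]
  rw [hs, add_sub_add_left_eq_sub, ← map_sub, norm_cumT hσ0, hi1]
  congr 2
  abel

lemma Tnode_congr {ω ω' : Omega d m σm σp} {u : JW m} (h : ω u = ω' u) :
    Tnode ω u = Tnode ω' u := by rw [Tnode, Tnode, h]

lemma xMap_congr (a : Fin m → E d) {ω ω' : Omega d m σm σp} (i : ℕ → Fin m) (p : ℕ)
    (h : ∀ u : JW m, p < u.1 → ω u = ω' u) : xMap a ω i p = xMap a ω' i p := by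
  have : ∀ q, cumTFrom ω i p q = cumTFrom ω' i p q := by
    intro q
    induction q with
    | zero => rfl
    | succ q ih =>
      have h1 : ω (pre i (p + 1 + q)) = ω' (pre i (p + 1 + q)) :=
        h _ (by change p < p + 1 + q; omega)
      rw [cumTFrom, cumTFrom, ih, Tnode_congr h1]
  simp only [xMap, this]

lemma measurable_label_act {α : Type*} [MeasurableSpace α] {l : α → Label d σm σp}
    (hl : Measurable l) {v : α → E d} (hv : Measurable v) :
    Measurable fun x => ((l x).1 : ℝ) • act d (l x).2 (v x) := by
  have h1 : Measurable fun x => ((l x).2, v x) := (measurable_snd.comp hl).prodMk hv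
  have h2 := (continuous_act d).measurable.comp h1
  simp only [Function.comp_def] at h2
  exact (measurable_rad.comp hl).smul h2

lemma measurable_Tnode {α : Type*} [MeasurableSpace α] {o : α → Omega d m σm σp}
    (ho : Measurable o) (u : JW m) {v : α → E d} (hv : Measurable v) :
    Measurable fun x => Tnode (o x) u (v x) := by
  simp only [Tnode, LinearMap.smul_apply]
  exact measurable_label_act ((measurable_pi_apply u).comp ho) hv

lemma measurable_cumT {α : Type*} [MeasurableSpace α] {o : α → Omega d m σm σp}
    (ho : Measurable o) (i : ℕ → Fin m) (n : ℕ) {v : α → E d} (hv : Measurable v) :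
    Measurable fun x => cumT (o x) i n (v x) := by
  induction n generalizing v with
  | zero => exact hv
  | succ n ih =>
    simp only [cumT, LinearMap.comp_apply]
    exact ih (measurable_Tnode ho _ hv)

lemma measurable_cumTFrom {α : Type*} [MeasurableSpace α] {o : α → Omega d m σm σp}
    (ho : Measurable o) (i : ℕ → Fin m) (p n : ℕ) {v : α → E d} (hv : Measurable v) :
    Measurable fun x => cumTFrom (o x) i p n (v x) := by
  induction n generalizing v with
  | zero => exact hv
  | succ n ih =>
    simp only [cumTFrom, LinearMap.comp_apply]
    exact ih (measurable_Tnode ho _ hv)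

/-- extend a finite word -/
def ext {n : ℕ} (u : Fin (n + 1) → Fin m) : ℕ → Fin m := fun j => u ⟨min j n, by omega⟩

lemma ext_pf (i : ℕ → Fin m) (n j : ℕ) (h : j ≤ n) : ext (pf i (n + 1)) j = i j := by
  simp [ext, pf, h]

lemma measurable_pf (n : ℕ) : Measurable fun i : ℕ → Fin m => pf i n :=
  measurable_pi_iff.2 fun _ => measurable_pi_apply _

lemma measurable_piMap (hσ0 : 0 < σm) (hσp : 0 ≤ σp) (hσ2 : σp < 1) (a : Fin m → E d) :
    Measurable fun x : Omega d m σm σp × (ℕ → Fin m) => piMap a x.1 x.2 := by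
  refine measurable_of_tendsto_metrizable
    (f := fun N (x : Omega d m σm σp × (ℕ → Fin m)) =>
      ∑ n ∈ Finset.range N, cumT x.1 x.2 n (a (x.2 n))) ?_ ?_
  · intro N
    refine Finset.measurable_sum _ fun n _ => ?_
    have h := measurable_eval_countable
      (fun (u : Fin (n + 1) → Fin m) (x : Omega d m σm σp × (ℕ → Fin m)) =>
        cumT x.1 (ext u) n (a (ext u n)))
      (fun u => measurable_cumT measurable_fst _ _ measurable_const)
      (fun x => pf x.2 (n + 1)) ((measurable_pf _).comp measurable_snd)
    convert h using 2 with x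
    rw [ext_pf _ _ _ le_rfl, cumT_congr x.1 fun j hj => ext_pf x.2 n j (by omega)]
  · rw [tendsto_pi_nhds]
    intro x
    exact (summable_cumT hσ0 hσp hσ2 a x.1 x.2).hasSum.tendsto_sum_nat

variable (θ : Measure (Od d)) [IsProbabilityMeasure θ] [θ.IsMulLeftInvariant]
  [IsProbabilityMeasure (labelM σm σp θ)]

local notation "PQ" => Measure.infinitePi (fun _ : JW m => labelM σm σp θ)

lemma pair_bound (hd : 1 ≤ d) (hσ0 : 0 < σm) (hσ1 : σm < σp) (hσ2 : σp < 1)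
    (a : Fin m → E d) (ha : Function.Injective a) {t : ℝ} (ht : 0 < t) (htd : t < d) :
    ∃ C : ℝ≥0∞, C ≠ ⊤ ∧ ∀ (u v : JW m), u ≠ v → ∀ b c, b ≠ c → ∀ x y : E d,
      ∫⁻ ω, ENNReal.ofReal ‖(a b - a c) + Tnode ω u x - Tnode ω v y‖ ^ (-t) ∂PQ ≤ C := by
  obtain ⟨δ, hδ0, hδ⟩ : ∃ δ : ℝ, 0 < δ ∧ ∀ b c, b ≠ c → δ ≤ ‖a b - a c‖ := by
    classical
    let S : Finset ℝ := insert 1 (((Finset.univ : Finset (Fin m × Fin m)).filter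
      fun x => x.1 ≠ x.2).image fun x => ‖a x.1 - a x.2‖)
    have hS : S.Nonempty := Finset.insert_nonempty _ _
    refine ⟨S.min' hS, ?_, fun b c hbc => Finset.min'_le _ _ ?_⟩
    · rw [Finset.lt_min'_iff]
      intro y hy
      simp only [S, Finset.mem_insert, Finset.mem_image, Finset.mem_filter] at hy
      rcases hy with rfl | ⟨x, ⟨_, hx⟩, rfl⟩
      · exact one_pos
      · exact norm_pos_iff.2 (sub_ne_zero.2 fun h => hx (ha h))
    · simp only [S, Finset.mem_insert, Finset.mem_image, Finset.mem_filter]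
      exact Or.inr ⟨(b, c), ⟨Finset.mem_univ _, hbc⟩, rfl⟩
  obtain ⟨C, hC, H⟩ := label_bound hd hσ0 hσ1 hσ2 θ ht htd (c := δ / 4) (by positivity)
  have hmeas : ∀ (u v : JW m) (z x y : E d), Measurable fun ω : Omega d m σm σp =>
      ENNReal.ofReal ‖z + Tnode ω u x - Tnode ω v y‖ ^ (-t) := by
    intro u v z x y
    exact ((((measurable_const.add (measurable_Tnode measurable_id u measurable_const)).sub
      (measurable_Tnode measurable_id v measurable_const)).norm).ennreal_ofReal).pow_const _
  have key : ∀ (u v : JW m), u ≠ v → ∀ z x y : E d, δ / 4 ≤ ‖x‖ →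
      ∫⁻ ω, ENNReal.ofReal ‖z + Tnode ω u x - Tnode ω v y‖ ^ (-t) ∂PQ ≤ C := by
    intro u v huv z x y hx
    conv_lhs => rw [← map_resamp (labelM σm σp θ) {u}]
    rw [lintegral_map (hmeas u v z x y) (measurable_resamp _),
      lintegral_prod (fun q => ENNReal.ofReal ‖z + Tnode (resamp {u} q) u x -
        Tnode (resamp {u} q) v y‖ ^ (-t))
        ((hmeas u v z x y).comp (measurable_resamp _)).aemeasurable]
    calc _ ≤ ∫⁻ ω : Omega d m σm σp, C ∂PQ := by
          refine lintegral_mono fun ω => ?_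
          have h1 : ∀ ω' : Omega d m σm σp,
              ENNReal.ofReal ‖z + Tnode (resamp {u} (ω, ω')) u x -
                Tnode (resamp {u} (ω, ω')) v y‖ ^ (-t) =
              ENNReal.ofReal ‖(z - Tnode ω v y) + ((ω' u).1 : ℝ) • act d (ω' u).2 x‖ ^ (-t) := by
            intro ω'
            rw [Tnode_congr (ω := resamp {u} (ω, ω')) (ω' := ω') (resamp_in _ rfl),
              Tnode_congr (ω := resamp {u} (ω, ω')) (ω' := ω)
                (resamp_out _ (fun h => huv (Set.mem_singleton_iff.1 h).symm))]
            congr 3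
            simp only [Tnode, LinearMap.smul_apply]
            abel
          simp only [h1]
          have hm2 : Measurable fun l : Label d σm σp =>
              ENNReal.ofReal ‖(z - Tnode ω v y) + (l.1 : ℝ) • act d l.2 x‖ ^ (-t) :=
            ((measurable_const.add (measurable_label_act measurable_id
              measurable_const)).norm.ennreal_ofReal).pow_const _
          rw [lintegral_eval (labelM σm σp θ) hm2 u]
          exact H x _ hx
      _ = C := by simp
  refine ⟨C + ENNReal.ofReal (δ / 2) ^ (-t), ?_, ?_⟩
  · refine ENNReal.add_ne_top.2 ⟨hC, ?_⟩
    apply ENNReal.rpow_ne_top_of_ne_zero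
    · simpa using hδ0
    · exact ENNReal.ofReal_ne_top
  · intro u v huv b c hbc x y
    by_cases hx : δ / 4 ≤ ‖x‖
    · exact (key u v huv _ x y hx).trans le_self_add
    by_cases hy : δ / 4 ≤ ‖y‖
    · have h2 : ∀ ω : Omega d m σm σp, ‖(a b - a c) + Tnode ω u x - Tnode ω v y‖ =
          ‖(a c - a b) + Tnode ω v y - Tnode ω u x‖ := by
        intro ω
        rw [← norm_neg]
        congr 1
        abel
      simp only [h2]
      exact (key v u huv.symm _ y x hy).trans le_self_add
    · push Not at hx hy
      refine le_trans ?_ le_add_self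
      calc _ ≤ ∫⁻ ω : Omega d m σm σp, ENNReal.ofReal (δ / 2) ^ (-t) ∂PQ := by
            refine lintegral_mono fun ω => ?_
            rw [ENNReal.rpow_neg, ENNReal.rpow_neg, ENNReal.inv_le_inv]
            refine ENNReal.rpow_le_rpow ?_ ht.le
            apply ENNReal.ofReal_le_ofReal
            have h1 : ‖Tnode ω u x‖ ≤ ‖x‖ := by
              rw [norm_Tnode hσ0]
              exact mul_le_of_le_one_left (norm_nonneg _) ((rad_le _).trans hσ2.le)
            have h2 : ‖Tnode ω v y‖ ≤ ‖y‖ := by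
              rw [norm_Tnode hσ0]
              exact mul_le_of_le_one_left (norm_nonneg _) ((rad_le _).trans hσ2.le)
            have h3 := norm_sub_norm_le (a b - a c) (Tnode ω v y - Tnode ω u x)
            have h4 := norm_sub_le (Tnode ω v y) (Tnode ω u x)
            have h5 := hδ b c hbc
            have h6 : (a b - a c) + Tnode ω u x - Tnode ω v y =
              (a b - a c) - (Tnode ω v y - Tnode ω u x) := by abel
            rw [h6]
            linarith
        _ = _ := by simp

end geom


set_option linter.unusedSectionVars false

section ker
open ProbabilityTheory
variable {m : ℕ} {Ω : Type*} [MeasurableSpace Ω]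

lemma measurable_mu {μ : Ω → Measure (ℕ → Fin m)} (hfin : ∀ ω, IsFiniteMeasure (μ ω))
    (hc : ∀ (k : ℕ) (w : Fin k → Fin m), Measurable fun ω => μ ω (cyl w)) : Measurable μ := by
  have := hfin
  refine Measurable.measure_of_isPiSystem generateFrom_cylSys isPiSystem_cylSys ?_ ?_
  · rintro S (rfl | ⟨k, w, rfl⟩)
    · simp
    · exact hc k w
  · have := hc 0 (fun i => i.elim0)
    simpa only [cyl_zero] using this

/-- the kernel given by a measurable family -/
noncomputable def kerOf (μ : Ω → Measure (ℕ → Fin m)) (h : Measurable μ) : Kernel Ω (ℕ → Fin m) :=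
  ⟨μ, h⟩

lemma sfin_of_finite {X : Type*} [MeasurableSpace X] (κ : Kernel Ω X)
    (hfin : ∀ ω, IsFiniteMeasure (κ ω)) : IsSFiniteKernel κ := by
  classical
  have hmu : Measurable fun ω => κ ω Set.univ := Kernel.measurable_coe κ MeasurableSet.univ
  have hS : ∀ n : ℕ, MeasurableSet {ω | ⌊(κ ω Set.univ).toNNReal⌋₊ = n} := fun n =>
    (Nat.measurable_floor.comp hmu.ennreal_toNNReal) (measurableSet_singleton n)
  refine ⟨⟨fun n => Kernel.piecewise (hS n) κ 0, fun n => ⟨⟨((n + 1 : ℕ) : ℝ≥0∞), by simp, ?_⟩⟩, ?_⟩⟩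
  · intro ω
    rw [Kernel.piecewise_apply]
    split_ifs with h
    · simp only [Set.mem_ofPred_eq] at h
      have h1 := Nat.lt_floor_add_one (κ ω Set.univ).toNNReal
      rw [h] at h1
      have h2 : ((κ ω Set.univ).toNNReal : ℝ≥0∞) = κ ω Set.univ :=
        ENNReal.coe_toNNReal (measure_ne_top _ _)
      rw [← h2]
      have : ((κ ω Set.univ).toNNReal : ℝ≥0∞) ≤ ((n + 1 : NNReal) : ℝ≥0∞) := by
        exact_mod_cast h1.le
      simpa using this
    · simp
  · ext ω s hs
    rw [Kernel.sum_apply' _ _ hs, tsum_eq_single ⌊(κ ω Set.univ).toNNReal⌋₊]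
    · rw [Kernel.piecewise_apply, if_pos (by simp)]
    · intro b hb
      rw [Kernel.piecewise_apply, if_neg]
      · simp
      · intro h; exact hb h.symm

lemma meas_pair {μ : Ω → Measure (ℕ → Fin m)} (hfin : ∀ ω, IsFiniteMeasure (μ ω))
    (hc : ∀ (k : ℕ) (w : Fin k → Fin m), Measurable fun ω => μ ω (cyl w))
    {F : Ω → (ℕ → Fin m) × (ℕ → Fin m) → ℝ≥0∞} (hF : Measurable (Function.uncurry F))
    {S : Set ((ℕ → Fin m) × (ℕ → Fin m))} (hS : MeasurableSet S) :
    Measurable fun ω => ∫⁻ z in S, F ω z ∂((μ ω).prod (μ ω)) := by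
  have hm := measurable_mu hfin hc
  let κ := kerOf μ hm
  have h1 : IsSFiniteKernel κ := sfin_of_finite κ hfin
  have h2 := Measurable.lintegral_kernel_prod_right (κ := (κ ×ₖ κ).restrict hS) hF
  simp only [Kernel.restrict_apply, Kernel.prod_apply] at h2
  exact h2

end ker

section scale
variable {m : ℕ} {L : Type*}

lemma Rp_scale (g : L → ℝ≥0∞) {p : ℕ} (w : Fin p → Fin m) (b : Fin m) {ω ω' : JW m → L}
    (h : ∀ u : JW m, u.1 ≠ p → ω u = ω' u) (l : ℕ) (hl : p + 1 ≤ l) :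
    ∀ v : Fin l → Fin m, (fun j => v (Fin.castLE hl j)) = sn w b →
      Rp g v ω' * g (ω (nd w b)) = Rp g v ω * g (ω' (nd w b)) := by
  induction l, hl using Nat.le_induction with
  | base =>
    intro v hv
    have : v = sn w b := hv
    subst this
    rw [Rp_sn, Rp_sn]
    have : Rp g w ω = Rp g w ω' := Rp_dep g w (fun u hu => h u (ne_of_lt hu))
    rw [this]; ring
  | succ l hl ih =>
    intro v hv
    have hv2 : v = sn (fun j => v (Fin.castSucc j)) (v (Fin.last l)) := by
      exact (Fin.snoc_init_self v).symm
    have h3 := ih (fun j => v (Fin.castSucc j)) hv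
    have h4 := h (nd (fun j => v (Fin.castSucc j)) (v (Fin.last l))) (by simp only [nd]; omega)
    rw [hv2, Rp_sn, Rp_sn, h4, mul_right_comm, h3, mul_right_comm]

variable [MeasurableSpace L]

lemma mu_scale {f : L → ℝ} (hf : ∀ l, 0 < f l)
    {μ : (JW m → L) → Measure (ℕ → Fin m)} (hfin : ∀ ω, IsFiniteMeasure (μ ω))
    (hc : ∀ ω k (w : Fin k → Fin m), μ ω (cyl w) = cm f w ω)
    {p : ℕ} (w : Fin p → Fin m) (b : Fin m) {ω ω' : JW m → L}
    (h : ∀ u : JW m, u.1 ≠ p → ω u = ω' u) (hω : ω ∈ Gd f m) (hω' : ω' ∈ Gd f m) :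
    (μ ω').restrict (cyl (sn w b)) =
      (ENNReal.ofReal (f (ω' (nd w b))) * (ENNReal.ofReal (f (ω (nd w b))))⁻¹) •
        (μ ω).restrict (cyl (sn w b)) := by
  have := hfin
  refine restrict_cyl_eq _ _ _ ?_
  intro l hl v hv
  rw [hc, hc, cm, cm, if_pos hω, if_pos hω']
  have h1 := Rp_scale (fun l => ENNReal.ofReal (f l)) w b h l hl v hv
  have h2 : Wl f v ω = Wl f v ω' := Wl_dep v (fun u hu => h u (by
    obtain ⟨h3, -⟩ := hu; omega))
  have h3 : ENNReal.ofReal (f (ω (nd w b))) ≠ 0 := by simpa using hf _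
  have h4 : ENNReal.ofReal (f (ω (nd w b))) ≠ ⊤ := ENNReal.ofReal_ne_top
  rw [h2]
  have h5 : Rp (fun l => ENNReal.ofReal (f l)) v ω' = Rp (fun l => ENNReal.ofReal (f l)) v ω *
      ENNReal.ofReal (f (ω' (nd w b))) * (ENNReal.ofReal (f (ω (nd w b))))⁻¹ := by
    rw [← h1, mul_assoc, ENNReal.mul_inv_cancel h3 h4, mul_one]
  rw [h5]; ring

end scale

section piece
variable {d m : ℕ} {σm σp : ℝ} (θ : Measure (Od d)) [IsProbabilityMeasure θ]
  [θ.IsMulLeftInvariant] [IsProbabilityMeasure (labelM σm σp θ)]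

local notation "PQ" => Measure.infinitePi (fun _ : JW m => labelM σm σp θ)

/-- the energy integrand -/
noncomputable def En (a : Fin m → E d) (t : ℝ) (ω : Omega d m σm σp)
    (z : (ℕ → Fin m) × (ℕ → Fin m)) : ℝ≥0∞ :=
  ENNReal.ofReal ‖piMap a ω z.1 - piMap a ω z.2‖ ^ (-t)

lemma meas_En (hσ0 : 0 < σm) (hσp : 0 ≤ σp) (hσ2 : σp < 1) (a : Fin m → E d) (t : ℝ) :
    Measurable (Function.uncurry (En (σm := σm) (σp := σp) a t)) := by
  have h := measurable_piMap hσ0 hσp hσ2 a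
  have h1 : Measurable fun x : Omega d m σm σp × ((ℕ → Fin m) × (ℕ → Fin m)) =>
      piMap a x.1 x.2.1 := h.comp (measurable_fst.prodMk measurable_snd.fst)
  have h2 : Measurable fun x : Omega d m σm σp × ((ℕ → Fin m) × (ℕ → Fin m)) =>
      piMap a x.1 x.2.2 := h.comp (measurable_fst.prodMk measurable_snd.snd)
  exact ((h1.sub h2).norm.ennreal_ofReal).pow_const (-t)

lemma En_resamp (hσ0 : 0 < σm) (hσp : 0 ≤ σp) (hσ2 : σp < 1) (a : Fin m → E d) {t : ℝ}
    {p : ℕ} (w : Fin p → Fin m) {b c : Fin m} {C : ℝ≥0∞}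
    (hC : ∀ x y : E d, ∫⁻ ω : Omega d m σm σp,
      ENNReal.ofReal ‖(a b - a c) + Tnode ω (nd w b) x - Tnode ω (nd w c) y‖ ^ (-t) ∂PQ ≤ C)
    (ω : Omega d m σm σp) {z : (ℕ → Fin m) × (ℕ → Fin m)}
    (hz : z ∈ cyl (sn w b) ×ˢ cyl (sn w c)) :
    ∫⁻ ω', En a t (resamp {nd w b, nd w c} (ω, ω')) z ∂PQ ≤
      ENNReal.ofReal (Rp rad w ω) ^ (-t) * C := by
  have hR : 0 < Rp rad w ω := Rp_rad_nonneg hσ0 w ω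
  have key : ∀ ω', En a t (resamp {nd w b, nd w c} (ω, ω')) z =
      ENNReal.ofReal (Rp rad w ω) ^ (-t) *
      ENNReal.ofReal ‖(a b - a c) + Tnode ω' (nd w b) (xMap a ω z.1 p)
        - Tnode ω' (nd w c) (xMap a ω z.2 p)‖ ^ (-t) := by
    intro ω'
    set η := resamp {nd w b, nd w c} (ω, ω') with hη
    have hout : ∀ u : JW m, u.1 ≠ p → η u = ω u := by
      intro u hu
      refine resamp_out (ω, ω') ?_
      rintro (rfl | rfl)
      · exact hu rfl
      · exact hu rfl
    have h1 : Rp rad w η = Rp rad w ω := Rp_dep rad w (fun u hu => hout u (ne_of_lt hu))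
    have h2 : Tnode η (nd w b) = Tnode ω' (nd w b) :=
      Tnode_congr (resamp_in (ω, ω') (by simp))
    have h3 : Tnode η (nd w c) = Tnode ω' (nd w c) :=
      Tnode_congr (resamp_in (ω, ω') (by simp))
    have h4 : ∀ i, xMap a η i p = xMap a ω i p := fun i =>
      xMap_congr a i p (fun u hu => hout u (ne_of_gt hu))
    rw [En, piMap_sub hσ0 hσp hσ2 a η w hz.1 hz.2, h1, h2, h3, h4, h4, ENNReal.ofReal_mul hR.le,
      ENNReal.mul_rpow_of_ne_top ENNReal.ofReal_ne_top ENNReal.ofReal_ne_top]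
  simp only [key]
  have h0 : ENNReal.ofReal (Rp rad w ω) ≠ 0 := by simpa using hR
  rw [lintegral_const_mul' _ _ (ENNReal.rpow_ne_top_of_ne_zero h0 ENNReal.ofReal_ne_top)]
  gcongr
  exact hC _ _

lemma Rp_g {f : Label d σm σp → ℝ} (hσ0 : 0 < σm) (t : ℝ)
    {p : ℕ} (w : Fin p → Fin m) (ω : Omega d m σm σp) :
    Rp (fun l => ENNReal.ofReal (rad l) ^ (-t) * ENNReal.ofReal (f l) ^ 2) w ω =
      ENNReal.ofReal (Rp rad w ω) ^ (-t) * Rp (fun l => ENNReal.ofReal (f l)) w ω ^ 2 := by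
  simp only [Rp]
  rw [Finset.prod_mul_distrib, Finset.prod_pow, ENNReal.prod_rpow_of_ne_top (by simp),
    ENNReal.ofReal_prod_of_nonneg (fun i _ => (rad_pos hσ0 _).le)]

lemma mu_le {f : Label d σm σp → ℝ} {q : ℝ} (hcasc : Casc m (labelM σm σp θ) f q)
    {μ : Omega d m σm σp → Measure (ℕ → Fin m)}
    (hc : ∀ ω k (w : Fin k → Fin m), μ ω (cyl w) = cm f w ω)
    {p : ℕ} (w : Fin p → Fin m) (b : Fin m) (ω : Omega d m σm σp) :
    μ ω (cyl (sn w b)) ≤ Rp (fun l => ENNReal.ofReal (f l)) w ω * Wl f (sn w b) ω := by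
  rw [hc, cm]
  split_ifs
  · rw [Rp_sn]
    gcongr
    calc _ ≤ Rp (fun l => ENNReal.ofReal (f l)) w ω * 1 := by
            gcongr
            simpa using hcasc.le1 _
      _ = _ := mul_one _
  · exact zero_le

set_option maxHeartbeats 1000000 in
lemma piece_bound (hσ0 : 0 < σm) (hσp : 0 ≤ σp) (hσ2 : σp < 1) (a : Fin m → E d) {t : ℝ}
    {f : Label d σm σp → ℝ} {q : ℝ} (hcasc : Casc m (labelM σm σp θ) f q)
    {K : ℝ≥0∞} (hK : ∀ l, (ENNReal.ofReal (f l))⁻¹ ≤ K)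
    {μ : Omega d m σm σp → Measure (ℕ → Fin m)} (hfin : ∀ ω, IsFiniteMeasure (μ ω))
    (hc : ∀ ω k (w : Fin k → Fin m), μ ω (cyl w) = cm f w ω)
    {p : ℕ} (w : Fin p → Fin m) {b c : Fin m} (hbc : b ≠ c) {C : ℝ≥0∞}
    (hC : ∀ x y : E d, ∫⁻ ω : Omega d m σm σp,
      ENNReal.ofReal ‖(a b - a c) + Tnode ω (nd w b) x - Tnode ω (nd w c) y‖ ^ (-t) ∂PQ ≤ C)
    (hCt : C ≠ ⊤) (hKt : K ≠ ⊤) :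
    ∫⁻ ω, ∫⁻ z in cyl (sn w b) ×ˢ cyl (sn w c), En a t ω z ∂((μ ω).prod (μ ω)) ∂PQ ≤
      K * K * C * (∫⁻ l, ENNReal.ofReal (rad l) ^ (-t) * ENNReal.ofReal (f l) ^ 2
        ∂(labelM σm σp θ)) ^ p := by
  have := hfin
  set A : Set (JW m) := {nd w b, nd w c} with hA
  have hout : ∀ ω ω' : Omega d m σm σp, ∀ u : JW m, u.1 ≠ p → ω u = resamp A (ω, ω') u := by
    intro ω ω' u hu
    refine (resamp_out (ω, ω') ?_).symm
    rintro (rfl | rfl)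
    · exact hu rfl
    · exact hu rfl
  have hS : MeasurableSet (cyl (sn w b) ×ˢ cyl (sn w c)) :=
    (measurableSet_cyl _).prod (measurableSet_cyl _)
  have hg2 : ∀ᵐ ω ∂PQ, ∀ᵐ ω' ∂PQ, resamp A (ω, ω') ∈ Gd f m := by
    refine Measure.ae_ae_of_ae_prod (p := fun z => resamp A z ∈ Gd f m) ?_
    refine ae_of_ae_map (f := resamp A) (measurable_resamp A).aemeasurable ?_
    rw [map_resamp]
    exact hcasc.ae_G
  have hk1 : ∀ (l l' : Label d σm σp), ENNReal.ofReal (f l) * (ENNReal.ofReal (f l'))⁻¹ ≤ K := by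
    intro l l'
    calc _ ≤ 1 * K := by
          gcongr
          · simpa using hcasc.le1 l
          · exact hK l'
      _ = K := one_mul _
  -- pointwise comparison
  have hpt : ∀ ω ω', ω ∈ Gd f m → resamp A (ω, ω') ∈ Gd f m →
      ∫⁻ z in cyl (sn w b) ×ˢ cyl (sn w c), En a t (resamp A (ω, ω')) z
        ∂((μ (resamp A (ω, ω'))).prod (μ (resamp A (ω, ω')))) ≤
      K * K * ∫⁻ z in cyl (sn w b) ×ˢ cyl (sn w c), En a t (resamp A (ω, ω')) z
        ∂((μ ω).prod (μ ω)) := by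
    intro ω ω' h1 h2
    rw [← Measure.prod_restrict, mu_scale hcasc.pos hfin hc w b (hout ω ω') h1 h2,
      mu_scale hcasc.pos hfin hc w c (hout ω ω') h1 h2, Measure.prod_smul_left,
      lintegral_smul_measure, Measure.prod_smul_right, lintegral_smul_measure, smul_eq_mul,
      smul_eq_mul, ← mul_assoc, Measure.prod_restrict]
    gcongr
    · exact hk1 _ _
    · exact hk1 _ _
  have hin : ∀ ω, ω ∈ Gd f m → (∀ᵐ ω' ∂PQ, resamp A (ω, ω') ∈ Gd f m) →
      ∫⁻ ω', ∫⁻ z in cyl (sn w b) ×ˢ cyl (sn w c), En a t (resamp A (ω, ω')) z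
        ∂((μ (resamp A (ω, ω'))).prod (μ (resamp A (ω, ω')))) ∂PQ ≤
      K * K * C * (Rp (fun l => ENNReal.ofReal (rad l) ^ (-t) * ENNReal.ofReal (f l) ^ 2) w ω *
        (Wl f (sn w b) ω * Wl f (sn w c) ω)) := by
    intro ω h1 h2
    have hm1 : Measurable (Function.uncurry
        (fun (ω' : Omega d m σm σp) z => En a t (resamp A (ω, ω')) z)) := by
      have h3 : Measurable fun x : Omega d m σm σp × ((ℕ → Fin m) × (ℕ → Fin m)) =>
        (resamp A (ω, x.1), x.2) :=
        ((measurable_resamp A).comp (measurable_const.prodMk measurable_fst)).prodMk measurable_snd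
      have h4 := (meas_En hσ0 hσp hσ2 a t).comp h3
      simp only [Function.comp_def] at h4
      exact h4
    calc _ ≤ ∫⁻ ω', K * K * ∫⁻ z in cyl (sn w b) ×ˢ cyl (sn w c), En a t (resamp A (ω, ω')) z
            ∂((μ ω).prod (μ ω)) ∂PQ := by
          refine lintegral_mono_ae ?_
          filter_upwards [h2] with ω' h3 using hpt ω ω' h1 h3
      _ = K * K * ∫⁻ z in cyl (sn w b) ×ˢ cyl (sn w c), ∫⁻ ω', En a t (resamp A (ω, ω')) z ∂PQ
            ∂((μ ω).prod (μ ω)) := by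
          rw [lintegral_const_mul' _ _ (ENNReal.mul_ne_top hKt hKt),
            lintegral_lintegral_swap hm1.aemeasurable]
      _ ≤ K * K * ∫⁻ z in cyl (sn w b) ×ˢ cyl (sn w c), ENNReal.ofReal (Rp rad w ω) ^ (-t) * C
            ∂((μ ω).prod (μ ω)) := by
          refine mul_le_mul_right ?_ _
          exact setLIntegral_mono measurable_const
            (fun z hz => En_resamp θ hσ0 hσp hσ2 a w hC ω hz)
      _ = K * K * (ENNReal.ofReal (Rp rad w ω) ^ (-t) * C *
            (μ ω (cyl (sn w b)) * μ ω (cyl (sn w c)))) := by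
          rw [setLIntegral_const, Measure.prod_prod]
      _ ≤ K * K * (ENNReal.ofReal (Rp rad w ω) ^ (-t) * C *
            ((Rp (fun l => ENNReal.ofReal (f l)) w ω * Wl f (sn w b) ω) *
            (Rp (fun l => ENNReal.ofReal (f l)) w ω * Wl f (sn w c) ω))) := by
          gcongr
          · exact mu_le θ hcasc hc w b ω
          · exact mu_le θ hcasc hc w c ω
      _ = _ := by rw [Rp_g hσ0]; ring
  have hmg : Measurable fun l : Label d σm σp =>
      ENNReal.ofReal (rad l) ^ (-t) * ENNReal.ofReal (f l) ^ 2 :=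
    (measurable_rad.ennreal_ofReal.pow_const _).mul (hcasc.meas.ennreal_ofReal.pow_const _)
  calc _ = ∫⁻ ω, ∫⁻ z in cyl (sn w b) ×ˢ cyl (sn w c), En a t ω z ∂((μ ω).prod (μ ω))
        ∂(((PQ).prod PQ).map (resamp A)) := by rw [map_resamp]
    _ ≤ _ := lintegral_map_le _ _
    _ ≤ _ := lintegral_prod_le _
    _ ≤ ∫⁻ ω, K * K * C * (Rp (fun l => ENNReal.ofReal (rad l) ^ (-t) *
          ENNReal.ofReal (f l) ^ 2) w ω * (Wl f (sn w b) ω * Wl f (sn w c) ω)) ∂PQ := by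
        refine lintegral_mono_ae ?_
        filter_upwards [hcasc.ae_G, hg2] with ω h1 h2 using hin ω h1 h2
    _ ≤ _ := by
        rw [lintegral_const_mul' _ _ (ENNReal.mul_ne_top (ENNReal.mul_ne_top hKt hKt) hCt)]
        gcongr
        have hne : sn w b ≠ sn w c := fun h => hbc (sn_inj h).2
        have hd2 : DependsOn (fun ω => Wl f (sn w b) ω * Wl f (sn w c) ω) (sub w) := by
          intro x y hxy
          have e1 : Wl f (sn w b) x = Wl f (sn w b) y :=
            Wl_dep _ (fun u hu => hxy u (sub_sn_subset w b hu))
          have e2 : Wl f (sn w c) x = Wl f (sn w c) y :=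
            Wl_dep _ (fun u hu => hxy u (sub_sn_subset w c hu))
          simp only [e1, e2]
        have hI := lint_Rp (labelM σm σp θ) hmg w
        rw [lintegral_indep (g := fun ω => Wl f (sn w b) ω * Wl f (sn w c) ω) (labelM σm σp θ) hI.1
          ((hcasc.measW (sn w b)).mul (hcasc.measW (sn w c))) (Rp_dep _ w) hd2 (disj_Rp w), hI.2,
          lintegral_indep (labelM σm σp θ) (hcasc.measW (sn w b)) (hcasc.measW (sn w c))
          (Wl_dep _) (Wl_dep _) (disj_sub _ _ hne)]
        calc _ ≤ (∫⁻ l, ENNReal.ofReal (rad l) ^ (-t) * ENNReal.ofReal (f l) ^ 2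
              ∂(labelM σm σp θ)) ^ p * (1 * 1) := by
              gcongr
              · exact hcasc.W_mean _
              · exact hcasc.W_mean _
          _ = _ := by simp
end piece


set_option linter.unusedSectionVars false

section diag
variable {m : ℕ} {L : Type*} [MeasurableSpace L] {ν : Measure L} [IsProbabilityMeasure ν]
  {f : L → ℝ} {q : ℝ}

local notation "PP" => Measure.infinitePi (fun _ : JW m => ν)

lemma diag_int (hcasc : Casc m ν f q) (n : ℕ) :
    ∫⁻ ω, ∑ w : Fin n → Fin m, cm f w ω ^ 2 ∂PP ≤
      ENNReal.ofReal q ^ n * ENNReal.ofReal (1 / (1 - q)) := by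
  have hmf : Measurable fun l => ENNReal.ofReal (f l) ^ 2 :=
    hcasc.meas.ennreal_ofReal.pow_const _
  have hq : (m : ℝ≥0∞) * ∫⁻ l, ENNReal.ofReal (f l) ^ 2 ∂ν = ENNReal.ofReal q := by
    rw [← hcasc.hq, ENNReal.ofReal_mul (by positivity), ENNReal.ofReal_natCast,
      ofReal_integral_eq_lintegral_ofReal]
    · simp only [ENNReal.ofReal_pow (hcasc.pos _).le]
    · refine Integrable.of_bound (hcasc.meas.pow_const 2).aestronglyMeasurable 1 ?_
      refine Eventually.of_forall fun l => ?_
      rw [Real.norm_eq_abs, abs_of_nonneg (by positivity)]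
      exact pow_le_one₀ (hcasc.pos l).le (hcasc.le1 l)
    · exact Eventually.of_forall fun l => by positivity
  rw [lintegral_finsetSum _ (fun w _ => (hcasc.meas_cm w).pow_const 2)]
  calc _ ≤ ∑ w : Fin n → Fin m, (∫⁻ l, ENNReal.ofReal (f l) ^ 2 ∂ν) ^ n *
          ENNReal.ofReal (1 / (1 - q)) := by
        refine Finset.sum_le_sum fun w _ => ?_
        have hI := lint_Rp (m := m) ν hmf w
        calc _ ≤ ∫⁻ ω, Rp (fun l => ENNReal.ofReal (f l) ^ 2) w ω * Wl f w ω ^ 2 ∂PP := by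
              refine lintegral_mono fun ω => ?_
              have : Rp (fun l => ENNReal.ofReal (f l) ^ 2) w ω =
                Rp (fun l => ENNReal.ofReal (f l)) w ω ^ 2 := by
                simp only [Rp, Finset.prod_pow]
              simp only [cm, this]
              split_ifs
              · rw [mul_pow]
              · simp
          _ = (∫⁻ l, ENNReal.ofReal (f l) ^ 2 ∂ν) ^ n * ∫⁻ ω, Wl f w ω ^ 2 ∂PP := by
              rw [lintegral_indep (g := fun ω => Wl f w ω ^ 2) ν hI.1
                ((hcasc.measW w).pow_const 2) (Rp_dep _ w)
                (DependsOn.comp' (Wl_dep w) (fun x => x ^ 2)) (disj_Rp w), hI.2]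
          _ ≤ _ := by
              gcongr
              exact hcasc.W_sq w
    _ = _ := by
        rw [Finset.sum_const, Finset.card_univ, Fintype.card_fun, Fintype.card_fin,
          Fintype.card_fin, nsmul_eq_mul, ← mul_assoc, ← hq, mul_pow]
        push_cast
        rfl

lemma diag_zero (hcasc : Casc m ν f q)
    {μ : (JW m → L) → Measure (ℕ → Fin m)} (hfin : ∀ ω, IsFiniteMeasure (μ ω))
    (hc : ∀ ω k (w : Fin k → Fin m), μ ω (cyl w) = cm f w ω) :
    ∀ᵐ ω ∂PP, ((μ ω).prod (μ ω)) {z | z.1 = z.2} = 0 := by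
  have := hfin
  have h1 : ∫⁻ ω, ⨅ n : ℕ, ∑ w : Fin n → Fin m, cm f w ω ^ 2 ∂PP = 0 := by
    refine le_antisymm ?_ zero_le
    have hlim : Tendsto (fun n : ℕ => ENNReal.ofReal q ^ n * ENNReal.ofReal (1 / (1 - q))) atTop
        (𝓝 (0 * ENNReal.ofReal (1 / (1 - q)))) := by
      refine ENNReal.Tendsto.mul_const ?_ (Or.inr ENNReal.ofReal_ne_top)
      refine ENNReal.tendsto_pow_atTop_nhds_zero_of_lt_one ?_
      simpa using hcasc.q1
    rw [zero_mul] at hlim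
    refine ge_of_tendsto' hlim fun n => ?_
    refine le_trans (lintegral_mono fun ω => iInf_le _ n) (diag_int hcasc n)
  rw [lintegral_eq_zero_iff] at h1
  · filter_upwards [h1] with ω hω
    refine le_antisymm ?_ zero_le
    simp only [Pi.zero_apply] at hω
    rw [← hω]
    refine le_iInf fun n => ?_
    calc _ ≤ ((μ ω).prod (μ ω)) (⋃ w : Fin n → Fin m, cyl w ×ˢ cyl w) := by
          refine measure_mono ?_
          rintro ⟨i, j⟩ hij
          simp only [Set.mem_ofPred_eq] at hij
          subst hij
          simp only [Set.mem_iUnion, Set.mem_prod, and_self, mem_cyl_iff]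
          exact ⟨_, rfl⟩
      _ ≤ ∑' w : Fin n → Fin m, ((μ ω).prod (μ ω)) (cyl w ×ˢ cyl w) := measure_iUnion_le _
      _ = _ := by
          rw [tsum_fintype]
          refine Finset.sum_congr rfl fun w _ => ?_
          rw [Measure.prod_prod, hc, sq]
  · exact Measurable.iInf fun n => Finset.measurable_fun_sum _
      fun w _ => (hcasc.meas_cm w).pow_const 2

end diag

section energy
variable {d m : ℕ} {σm σp : ℝ} (θ : Measure (Od d)) [IsProbabilityMeasure θ]
  [θ.IsMulLeftInvariant] [IsProbabilityMeasure (labelM σm σp θ)]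

local notation "PQ" => Measure.infinitePi (fun _ : JW m => labelM σm σp θ)

/-- branching data -/
abbrev Br (m : ℕ) : Type := Σ p : ℕ, (Fin p → Fin m) × {bc : Fin m × Fin m // bc.1 ≠ bc.2}

lemma cover (z : (ℕ → Fin m) × (ℕ → Fin m)) (hz : z.1 ≠ z.2) :
    ∃ x : Br m, z ∈ cyl (sn x.2.1 x.2.2.1.1) ×ˢ cyl (sn x.2.1 x.2.2.1.2) := by
  classical
  have h : ∃ n, z.1 n ≠ z.2 n := by
    by_contra h
    push Not at h
    exact hz (funext h)
  let p := Nat.find h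
  have hp : z.1 p ≠ z.2 p := Nat.find_spec h
  have hlt : pf z.1 p = pf z.2 p := by
    funext j
    have := Nat.find_min h j.2
    push Not at this
    exact this
  refine ⟨⟨p, pf z.1 p, ⟨(z.1 p, z.2 p), hp⟩⟩, ?_, ?_⟩
  · simp only [mem_cyl_iff]
    exact pf_succ _ _
  · simp only [mem_cyl_iff]
    rw [hlt]
    exact pf_succ _ _

lemma energy (hd : 1 ≤ d) (hσ0 : 0 < σm) (hσ1 : σm < σp) (hσ2 : σp < 1) (a : Fin m → E d)
    (ha : Function.Injective a) {t : ℝ} (ht : 0 < t) (htd : t < d)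
    {f : Label d σm σp → ℝ} {q : ℝ} (hcasc : Casc m (labelM σm σp θ) f q)
    {K : ℝ≥0∞} (hK : ∀ l, (ENNReal.ofReal (f l))⁻¹ ≤ K) (hKt : K ≠ ⊤)
    {μ : Omega d m σm σp → Measure (ℕ → Fin m)} (hfin : ∀ ω, IsFiniteMeasure (μ ω))
    (hc : ∀ ω k (w : Fin k → Fin m), μ ω (cyl w) = cm f w ω)
    (hlt : m * ∫⁻ l, ENNReal.ofReal (rad l) ^ (-t) * ENNReal.ofReal (f l) ^ 2
        ∂(labelM σm σp θ) < 1) :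
    ∫⁻ ω, (∫⁻ i, ∫⁻ j,
      (ENNReal.ofReal ‖piMap a ω i - piMap a ω j‖) ^ (-t) ∂(μ ω) ∂(μ ω)) ∂PQ < ⊤ := by
  have := hfin
  have hσp : 0 ≤ σp := (hσ0.trans hσ1).le
  obtain ⟨C, hCt, hC⟩ := pair_bound (m := m) θ hd hσ0 hσ1 hσ2 a ha ht htd
  set I := ∫⁻ l, ENNReal.ofReal (rad l) ^ (-t) * ENNReal.ofReal (f l) ^ 2
        ∂(labelM σm σp θ) with hI
  let S : Br m → Set ((ℕ → Fin m) × (ℕ → Fin m)) := fun x =>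
    cyl (sn x.2.1 x.2.2.1.1) ×ˢ cyl (sn x.2.1 x.2.2.1.2)
  have hS : ∀ x, MeasurableSet (S x) := fun x => (measurableSet_cyl _).prod (measurableSet_cyl _)
  have hF := meas_En (m := m) hσ0 hσp hσ2 a t
  have hcm : ∀ (k : ℕ) (w : Fin k → Fin m), Measurable fun ω => μ ω (cyl w) := by
    intro k w
    simp only [hc]
    exact hcasc.meas_cm w
  have hne : ∀ x : Br m, nd x.2.1 x.2.2.1.1 ≠ nd x.2.1 x.2.2.1.2 := by
    rintro ⟨p, w, ⟨b, c⟩, hbc⟩ h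
    simp only [nd, Sigma.mk.injEq, heq_eq_eq, true_and] at h
    exact hbc (sn_inj h).2
  have hpiece : ∀ x : Br m, ∫⁻ ω, ∫⁻ z in S x, En a t ω z ∂((μ ω).prod (μ ω)) ∂PQ ≤
      K * K * C * I ^ x.1 := fun x =>
    piece_bound θ hσ0 hσp hσ2 a hcasc hK hfin hc x.2.1 x.2.2.2 (hC _ _ (hne x) _ _ x.2.2.2) hCt hKt
  calc _ ≤ ∫⁻ ω, ∑' x : Br m, ∫⁻ z in S x, En a t ω z ∂((μ ω).prod (μ ω)) ∂PQ := by
        refine lintegral_mono_ae ?_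
        filter_upwards [diag_zero hcasc hfin hc] with ω hω
        have hFω : Measurable (En a t ω) := hF.of_uncurry_left
        have e1 : ∫⁻ i, ∫⁻ j, (ENNReal.ofReal ‖piMap a ω i - piMap a ω j‖) ^ (-t) ∂(μ ω) ∂(μ ω)
          = ∫⁻ z, En a t ω z ∂((μ ω).prod (μ ω)) :=
          (lintegral_prod _ hFω.aemeasurable).symm
        rw [e1]
        calc _ = ∫⁻ z in {z | z.1 = z.2} ∪ ⋃ x, S x, En a t ω z ∂((μ ω).prod (μ ω)) := by
              have : {z : (ℕ → Fin m) × (ℕ → Fin m) | z.1 = z.2} ∪ ⋃ x, S x = Set.univ := by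
                refine Set.eq_univ_of_forall fun z => ?_
                by_cases hz : z.1 = z.2
                · exact Or.inl hz
                · exact Or.inr (Set.mem_iUnion.2 (cover z hz))
              rw [this, Measure.restrict_univ]
          _ ≤ _ := lintegral_union_le _ _ _
          _ = ∫⁻ z in ⋃ x, S x, En a t ω z ∂((μ ω).prod (μ ω)) := by
              rw [setLIntegral_measure_zero _ _ hω, zero_add]
          _ ≤ _ := lintegral_iUnion_le _ _
    _ = ∑' x : Br m, ∫⁻ ω, ∫⁻ z in S x, En a t ω z ∂((μ ω).prod (μ ω)) ∂PQ :=
        lintegral_tsum fun x => (meas_pair hfin hcm hF (hS x)).aemeasurable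
    _ ≤ ∑' x : Br m, K * K * C * I ^ x.1 := ENNReal.tsum_le_tsum hpiece
    _ = ∑' p : ℕ, ∑' y : (Fin p → Fin m) × {bc : Fin m × Fin m // bc.1 ≠ bc.2},
          K * K * C * I ^ p := ENNReal.tsum_sigma' _
    _ = ∑' p : ℕ, (K * K * C * (Fintype.card {bc : Fin m × Fin m // bc.1 ≠ bc.2})) *
          (m * I) ^ p := by
        refine tsum_congr fun p => ?_
        rw [tsum_fintype, Finset.sum_const, Finset.card_univ, Fintype.card_prod, Fintype.card_fun,
          Fintype.card_fin, Fintype.card_fin, nsmul_eq_mul, mul_pow]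
        push_cast
        ring
    _ < ⊤ := by
        rw [ENNReal.tsum_mul_left, ENNReal.tsum_geometric]
        refine ENNReal.mul_lt_top ?_ ?_
        · exact ENNReal.mul_lt_top (ENNReal.mul_lt_top (ENNReal.mul_lt_top hKt.lt_top hKt.lt_top)
            hCt.lt_top) (ENNReal.natCast_lt_top _)
        · exact ENNReal.inv_lt_top.2 (tsub_pos_of_lt hlt)

end energy


set_option linter.unusedSectionVars false

section fin
variable {d m : ℕ} {σm σp : ℝ} (θ : Measure (Od d)) [IsProbabilityMeasure θ]

lemma lint_rad {h : ℝ → ℝ≥0∞} (hh : Measurable h) :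
    ∫⁻ l, h (rad l) ∂(labelM σm σp θ) =
      (ENNReal.ofReal (σp - σm))⁻¹ * ∫⁻ r in Set.Ioo σm σp, h r := by
  refine lintegral_labelM θ _ (hh.comp measurable_rad) h fun r => ?_
  simp [rad]

lemma prob_label (h : σm < σp) : IsProbabilityMeasure (labelM σm σp θ) := by
  constructor
  have := lint_rad (σm := σm) (σp := σp) θ (h := fun _ => 1) measurable_const
  simp only [lintegral_one, Measure.restrict_apply MeasurableSet.univ, Set.univ_inter,
    Real.volume_Ioo] at this
  rw [this]
  exact ENNReal.inv_mul_cancel (by simpa using h) ENNReal.ofReal_ne_top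

lemma mean_lint (hσ0 : 0 < σm) (h : σm < σp) {s : ℝ} (hs0 : 0 < s)
    (hs : ((m : ℝ) / (σp - σm)) * (∫ r in σm..σp, r ^ s) = 1) :
    (m : ℝ≥0∞) * ∫⁻ l, ENNReal.ofReal (rad l ^ s) ∂(labelM σm σp θ) = 1 := by
  have hpos : 0 < σp - σm := sub_pos.2 h
  rw [lint_rad θ (h := fun r => ENNReal.ofReal (r ^ s)) (by fun_prop)]
  have hint : IntegrableOn (fun r : ℝ => r ^ s) (Set.Ioo σm σp) := by
    refine IntegrableOn.mono_set (t := Set.Icc σm σp) ?_ Set.Ioo_subset_Icc_self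
    refine ContinuousOn.integrableOn_Icc ?_
    exact (Real.continuous_rpow_const hs0.le).continuousOn
  rw [← ofReal_integral_eq_lintegral_ofReal hint, ← ENNReal.ofReal_inv_of_pos hpos,
    ← ENNReal.ofReal_mul (by positivity), ← ENNReal.ofReal_natCast,
    ← ENNReal.ofReal_mul (by positivity), ← integral_Ioc_eq_integral_Ioo,
    ← intervalIntegral.integral_of_le h.le, ← mul_assoc, ← div_eq_mul_inv, hs, ENNReal.ofReal_one]
  rw [EventuallyLE, ae_restrict_iff' measurableSet_Ioo]
  refine Eventually.of_forall fun r hr => ?_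
  exact Real.rpow_nonneg (hσ0.trans hr.1).le _

lemma casc_inst (hm : 2 ≤ m) (hσ0 : 0 < σm) (h : σm < σp) (hσ2 : σp < 1) {s : ℝ} (hs0 : 0 < s)
    (hs : ((m : ℝ) / (σp - σm)) * (∫ r in σm..σp, r ^ s) = 1) :
    ∃ q, Casc m (labelM σm σp θ) (fun l => rad l ^ s) q := by
  have := prob_label θ h
  have hmeas : Measurable fun l : Label d σm σp => rad l ^ s := measurable_rad.pow_const s
  have hpos : ∀ l : Label d σm σp, 0 < rad l ^ s := fun l => Real.rpow_pos_of_pos (rad_pos hσ0 l) _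
  have hle : ∀ l : Label d σm σp, rad l ^ s ≤ σp ^ s := fun l =>
    Real.rpow_le_rpow (rad_pos hσ0 l).le (rad_le l) hs0.le
  have hs1 : σp ^ s < 1 := Real.rpow_lt_one (hσ0.trans h).le hσ2 hs0
  have hmean : (m : ℝ) * ∫ l, rad l ^ s ∂(labelM σm σp θ) = 1 := by
    have h1 := congrArg ENNReal.toReal (mean_lint (m := m) θ hσ0 h hs0 hs)
    rw [ENNReal.toReal_mul] at h1
    rw [integral_eq_lintegral_of_nonneg_ae (Eventually.of_forall fun l => (hpos l).le)
      hmeas.aestronglyMeasurable]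
    simpa using h1
  have hint : Integrable (fun l : Label d σm σp => rad l ^ s) (labelM σm σp θ) := by
    refine Integrable.of_bound hmeas.aestronglyMeasurable 1 (Eventually.of_forall fun l => ?_)
    rw [Real.norm_eq_abs, abs_of_pos (hpos l)]
    exact (hle l).trans hs1.le
  refine ⟨_, hm, hmeas, hpos, fun l => (hle l).trans hs1.le, hmean, rfl, ?_, ?_⟩
  · exact mul_nonneg (by positivity) (integral_nonneg fun l => by positivity)
  · refine lt_of_le_of_lt ?_ hs1
    have h2 : ∫ l, (rad l ^ s) ^ 2 ∂(labelM σm σp θ) ≤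
        ∫ l, σp ^ s * rad l ^ s ∂(labelM σm σp θ) := by
      refine integral_mono_of_nonneg (Eventually.of_forall fun l => by positivity)
        (hint.const_mul _) (Eventually.of_forall fun l => ?_)
      simp only [sq]
      exact mul_le_mul_of_nonneg_right (hle l) (hpos l).le
    rw [integral_const_mul] at h2
    calc _ ≤ (m : ℝ) * (σp ^ s * ∫ l, rad l ^ s ∂(labelM σm σp θ)) := by gcongr
      _ = σp ^ s * ((m : ℝ) * ∫ l, rad l ^ s ∂(labelM σm σp θ)) := by ring
      _ = _ := by rw [hmean, mul_one]

lemma g_bound (hσ0 : 0 < σm) (h : σm < σp) (hσ2 : σp < 1) {s t : ℝ} (hs0 : 0 < s) (hts : t < s)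
    (hs : ((m : ℝ) / (σp - σm)) * (∫ r in σm..σp, r ^ s) = 1) :
    m * ∫⁻ l, ENNReal.ofReal (rad l) ^ (-t) * ENNReal.ofReal (rad l ^ s) ^ 2
        ∂(labelM σm σp θ) < 1 := by
  have hb : ∀ l : Label d σm σp, ENNReal.ofReal (rad l) ^ (-t) * ENNReal.ofReal (rad l ^ s) ^ 2 ≤
      ENNReal.ofReal (σp ^ (s - t)) * ENNReal.ofReal (rad l ^ s) := by
    intro l
    have hr := rad_pos hσ0 l
    rw [ENNReal.ofReal_rpow_of_pos hr, ← ENNReal.ofReal_pow (by positivity),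
      ← ENNReal.ofReal_mul (by positivity), ← ENNReal.ofReal_mul
        (Real.rpow_nonneg (hσ0.trans h).le _)]
    refine ENNReal.ofReal_le_ofReal ?_
    have e : rad l ^ (-t) * (rad l ^ s) ^ 2 = rad l ^ (s - t) * rad l ^ s := by
      rw [sq, ← mul_assoc, ← Real.rpow_add hr]
      congr 2; ring
    rw [e]
    gcongr
    exact rad_le l
  calc _ ≤ (m : ℝ≥0∞) * ∫⁻ l, ENNReal.ofReal (σp ^ (s - t)) * ENNReal.ofReal (rad l ^ s)
        ∂(labelM σm σp θ) := by
        exact mul_le_mul_right (lintegral_mono hb) _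
    _ = ENNReal.ofReal (σp ^ (s - t)) := by
        rw [lintegral_const_mul' _ _ ENNReal.ofReal_ne_top, mul_left_comm,
          mean_lint (m := m) θ hσ0 h hs0 hs, mul_one]
    _ < 1 := by
        rw [ENNReal.ofReal_lt_one]
        exact Real.rpow_lt_one (hσ0.trans h).le hσ2 (sub_pos.2 hts)

end fin



/-- Theorem 4.7 (1): there are random measures `(μ^ω)` on `J_∞`, with measurable cylinder
masses and a.s. `0 < μ^ω(J_∞) < ∞`, whose expected `t`-energy under `π(·,ω)` is finite for
every `0 < t < min{s, d}`. -/
theorem stmt15 (d m : ℕ) (hd : 1 ≤ d) (hm : 2 ≤ m)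
    (σm σp : ℝ) (hσ0 : 0 < σm) (hσ1 : σm ≤ σp) (hσ2 : σp < 1)
    (a : Fin m → E d) (ha : Function.Injective a)
    (θ : Measure (Od d)) (hθ1 : IsProbabilityMeasure θ) (hθ2 : θ.IsMulLeftInvariant)
    (P : Measure (Omega d m σm σp)) (hP1 : IsProbabilityMeasure P)
    (hP2 : IsProductLaw θ P)
    (s : ℝ) (hs0 : 0 < s)
    (hs : ((m : ℝ) / (σp - σm)) * (∫ r in σm..σp, r ^ s) = 1) :
    ∃ μ : Omega d m σm σp → Measure (ℕ → Fin m),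
      (∀ ω, IsFiniteMeasure (μ ω)) ∧
      (∀ (k : ℕ) (w : Fin k → Fin m), Measurable fun ω => μ ω (cyl w)) ∧
      (∀ᵐ ω ∂P, 0 < μ ω Set.univ ∧ μ ω Set.univ < ⊤) ∧
      ∀ t : ℝ, 0 < t → t < min s (d : ℝ) →
        ∫⁻ ω, (∫⁻ i, ∫⁻ j,
            (ENNReal.ofReal ‖piMap a ω i - piMap a ω j‖) ^ (-t) ∂(μ ω) ∂(μ ω)) ∂P < ⊤ := by
  have h : σm < σp := by
    refine lt_of_le_of_ne hσ1 ?_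
    rintro rfl
    simp at hs
  have hpl := prob_label (σm := σm) (σp := σp) θ h
  have hP : P = Measure.infinitePi (fun _ : JW m => labelM σm σp θ) := by
    refine Measure.eq_infinitePi _ ?_
    intro S A hA
    exact hP2 S A hA
  obtain ⟨q, hcasc⟩ := casc_inst (m := m) θ hm hσ0 h hσ2 hs0 hs
  obtain ⟨μ, hfin, hc⟩ := hcasc.exists_mu
  refine ⟨μ, hfin, ?_, ?_, ?_⟩
  · intro k w
    simp only [hc]
    exact hcasc.meas_cm w
  · rw [hP]
    filter_upwards [hcasc.ae_G, hcasc.pos_ae (fun i : Fin 0 => i.elim0)] with ω h1 h2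
    have := hfin ω
    refine ⟨?_, measure_lt_top _ _⟩
    rw [← cyl_zero (fun i : Fin 0 => i.elim0), hc, cm, if_pos h1, Rp_zero, one_mul]
    exact pos_iff_ne_zero.2 h2
  · intro t ht htm
    rw [hP]
    refine energy θ hd hσ0 h hσ2 a ha ht (htm.trans_le (min_le_right _ _)) hcasc
      (K := (ENNReal.ofReal (σm ^ s))⁻¹) ?_ ?_ hfin hc
      (g_bound θ hσ0 h hσ2 hs0 (htm.trans_le (min_le_left _ _)) hs)
    · intro l
      refine ENNReal.inv_le_inv.2 (ENNReal.ofReal_le_ofReal ?_)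
      exact Real.rpow_le_rpow hσ0.le l.1.2.1.le hs0.le
    · rw [ENNReal.inv_ne_top]
      simpa using Real.rpow_pos_of_pos hσ0 s
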